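/- Let f₀(x) = (x¹² + 24x¹¹ + 204x¹⁰ + 912x⁹ + 2676x⁸ + 4032x⁷ + 9056x⁶ − 1920x⁵ + 7728x⁴ − 16512x³ − 20544x² − 6912x − 1088) − 40·(x² − 2)³·(x³ + 3x² + 6x + 2) ∈ ℚ[x]. Then f₀ is irreducible over ℚ, the Galois group of its splitting field over ℚ is a simple group of cardinality 7920 (i.e., isomorphic to the Mathieu group M₁₁), and the root field K = ℚ[x]/(f₀) is a degree-12 number field with discriminant 2²²·6451⁴. -/

import Mathlib

open Polynomial

/-- `f₀(x) = (x¹² + 24x¹¹ + 204x¹⁰ + 912x⁹ + 2676x⁸ + 4032x⁷ + 9056x⁶ − 1920x⁵ + 7728x⁴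
  − 16512x³ − 20544x² − 6912x − 1088) − 40(x²−2)³(x³+3x²+6x+2)` over `ℚ`. -/
noncomputable def f0 : Polynomial ℚ :=
  (X ^ 12 + 24 * X ^ 11 + 204 * X ^ 10 + 912 * X ^ 9 + 2676 * X ^ 8 + 4032 * X ^ 7 +
      9056 * X ^ 6 - 1920 * X ^ 5 + 7728 * X ^ 4 - 16512 * X ^ 3 - 20544 * X ^ 2 -
      6912 * X - 1088) -
    C (40 : ℚ) * ((X ^ 2 - 2) ^ 3 * (X ^ 3 + 3 * X ^ 2 + 6 * X + 2))


namespace M11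

/-- Paley block indicator. -/
def Hb (j x : ℕ) : Bool := x == 11 || [1, 3, 4, 5, 9].contains ((x + 11 - j) % 11)

def Aut (π : Equiv.Perm (Fin 12)) : Prop :=
  ∀ j : Fin 11, ∃ j' : Fin 11, ∀ x y : Fin 12,
    (Hb j x = Hb j y ↔ Hb j' (π x) = Hb j' (π y))

def okL (l : List ℕ) : Bool :=
  (List.range 11).all fun j => (List.range 11).any fun k =>
    (List.range l.length).all fun i => Hb j i == Hb k (l.getD i 0)

def extL (l : List ℕ) : List (List ℕ) :=
  (((List.range 11).filter fun v => !(l.contains v)).map fun v => l ++ [v]).filter okL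

def levL : ℕ → List (List ℕ)
  | 0 => [[0, 1]]
  | n + 1 => (levL n).flatMap extL

theorem levL_len : (levL 9).length = 6 := by decide +kernel

theorem Hb_inf (j : ℕ) : Hb j 11 = true := by simp [Hb]

theorem aut_inf {π : Equiv.Perm (Fin 12)} (h : Aut π) (h11 : π 11 = 11) (j : Fin 11) :
    ∃ j' : Fin 11, ∀ x : Fin 12, Hb j x = Hb j' (π x) := by
  obtain ⟨j', hj⟩ := h j
  refine ⟨j', fun x => ?_⟩
  have := hj x 11
  rw [h11] at this
  have e : ∀ j : Fin 11, Hb j ((11 : Fin 12) : ℕ) = true := fun j => Hb_inf j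
  rw [e, e] at this
  cases h1 : Hb j x <;> cases h2 : Hb j' (π x) <;> simp_all

theorem lev_mem {π : Equiv.Perm (Fin 12)} (h : Aut π) (h11 : π 11 = 11) (h0 : π 0 = 0)
    (h1 : π 1 = 1) (n : ℕ) (hn : n ≤ 9) :
    (List.range (n + 2)).map (fun i => ((π (Fin.ofNat 12 i) : Fin 12) : ℕ)) ∈ levL n := by
  induction n with
  | zero =>
    simp [levL, List.range_succ, h0]
    exact congrArg Fin.val h1
  | succ n ih =>
    have ih := ih (by omega)
    rw [levL, List.mem_flatMap]
    refine ⟨_, ih, ?_⟩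
    have hlt : ∀ i, i < 11 → ((π (Fin.ofNat 12 i) : Fin 12) : ℕ) < 11 := by
      intro i hi
      have h3 : π (Fin.ofNat 12 i) ≠ 11 := by
        intro hh
        have := π.injective (hh.trans h11.symm)
        have := congrArg Fin.val this
        simp at this; omega
      have := (π (Fin.ofNat 12 i)).isLt
      have h4 : ((π (Fin.ofNat 12 i) : Fin 12) : ℕ) ≠ 11 := fun hh => h3 (Fin.ext hh)
      omega
    unfold extL
    rw [List.mem_filter]
    constructor
    · rw [List.mem_map]
      refine ⟨((π (Fin.ofNat 12 (n + 2)) : Fin 12) : ℕ), ?_, ?_⟩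
      · rw [List.mem_filter]
        refine ⟨List.mem_range.2 (hlt _ (by omega)), ?_⟩
        simp only [List.contains_eq_mem, Bool.not_eq_true', decide_eq_false_iff_not, List.mem_map,
          List.mem_range, not_exists, not_and]
        intro i hi hh
        have := congrArg Fin.val (π.injective (Fin.ext hh))
        simp at this
        omega
      · rw [List.range_succ (n := n + 2), List.map_append]; rfl
    · unfold okL
      rw [List.all_eq_true]
      intro j hj
      rw [List.mem_range] at hj
      obtain ⟨j', hj'⟩ := aut_inf h h11 ⟨j, hj⟩
      rw [List.any_eq_true]
      refine ⟨j', List.mem_range.2 j'.isLt, ?_⟩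
      rw [List.all_eq_true]
      intro i hi
      rw [List.mem_range, List.length_map, List.length_range] at hi
      have := hj' (Fin.ofNat 12 i)
      have h5 : ((Fin.ofNat 12 i : Fin 12) : ℕ) = i := by simp; omega
      rw [h5] at this
      simp only [beq_iff_eq]
      rw [this]
      congr 1
      rw [List.getD_eq_getElem?_getD, List.getElem?_map, List.getElem?_range hi]
      rfl

open Classical in
theorem stab_card (S : Finset (Equiv.Perm (Fin 12)))
    (hS : ∀ π ∈ S, Aut π ∧ π 11 = 11 ∧ π 0 = 0 ∧ π 1 = 1) : S.card ≤ 6 := by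
  let F : Equiv.Perm (Fin 12) → List ℕ := fun π =>
    (List.range 11).map (fun i => ((π (Fin.ofNat 12 i) : Fin 12) : ℕ))
  have h1 : S.card ≤ (levL 9).toFinset.card := by
    apply Finset.card_le_card_of_injOn F
    · intro π hπ
      obtain ⟨a, b, c, d⟩ := hS π hπ
      simp only [List.coe_toFinset, Set.mem_ofPred_eq]
      exact lev_mem a b c d 9 le_rfl
    · intro π hπ π' hπ' hF
      obtain ⟨a, b, c, d⟩ := hS π hπ
      obtain ⟨a', b', c', d'⟩ := hS π' hπ'
      ext x
      by_cases hx : x = 11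
      · rw [hx, b, b']
      · have hx' : (x : ℕ) < 11 := by
          have := x.isLt
          have : (x : ℕ) ≠ 11 := fun hh => hx (Fin.ext hh)
          omega
        have := congrArg (fun l => l.getD (x : ℕ) 0) hF
        simp only [F, List.getD_eq_getElem?_getD, List.getElem?_map, List.getElem?_range hx'] at this
        simpa using this
  exact h1.trans ((List.toFinset_card_le _).trans levL_len.le)

theorem aut_mul_inv {π ρ : Equiv.Perm (Fin 12)} (G : Subgroup (Equiv.Perm (Fin 12)))
    (hA : ∀ π ∈ G, Aut π) (h : π ∈ G) (h' : ρ ∈ G) : Aut (ρ⁻¹ * π) :=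
  hA _ (G.mul_mem (G.inv_mem h') h)

open Classical in
theorem card_le (G : Subgroup (Equiv.Perm (Fin 12))) (hA : ∀ π ∈ G, Aut π) :
    Nat.card G ≤ 7920 := by
  let S : Finset (Equiv.Perm (Fin 12)) := Finset.univ.filter (· ∈ G)
  have hc : Nat.card G = S.card := by
    rw [Nat.card_eq_fintype_card, Fintype.card_subtype]
  rw [hc]
  let T : Finset (Fin 12 × Fin 12 × Fin 12) :=
    Finset.univ.filter fun t => t.1 ≠ t.2.1 ∧ t.1 ≠ t.2.2 ∧ t.2.1 ≠ t.2.2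
  let F : Equiv.Perm (Fin 12) → Fin 12 × Fin 12 × Fin 12 := fun π => (π 11, π 0, π 1)
  have hT : T.card = 1320 := by
    have : T = (Finset.univ : Finset (Fin 12)).biUnion fun a => (Finset.univ.erase a).biUnion
      fun b => ((Finset.univ.erase a).erase b).image fun c => (a, b, c) := by
      ext ⟨a, b, c⟩
      simp [T]
      tauto
    rw [this, Finset.card_biUnion]
    · have : ∀ a ∈ (Finset.univ : Finset (Fin 12)), ((Finset.univ.erase a).biUnion
        fun b => ((Finset.univ.erase a).erase b).image fun c => (a, b, c)).card = 110 := by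
        intro a _
        rw [Finset.card_biUnion]
        · have : ∀ b ∈ Finset.univ.erase a,
            (((Finset.univ.erase a).erase b).image fun c => (a, b, c)).card = 10 := by
            intro b hb
            rw [Finset.card_image_of_injective _ (fun x y h => by simpa using h),
              Finset.card_erase_of_mem hb, Finset.card_erase_of_mem (Finset.mem_univ _)]
            simp
          rw [Finset.sum_congr rfl this]
          simp
        · intro b _ b' _ hbb
          rw [Function.onFun, Finset.disjoint_left]
          simp only [Finset.mem_image]
          rintro _ ⟨c, _, rfl⟩ ⟨c', _, h⟩
          simp at h; exact hbb h.1.symm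
      rw [Finset.sum_congr rfl this]
      simp
    · intro b _ b' _ hbb
      rw [Function.onFun, Finset.disjoint_left]
      simp only [Finset.mem_biUnion, Finset.mem_image]
      rintro _ ⟨d, _, c, _, rfl⟩ ⟨d', _, c', _, h⟩
      simp at h; exact hbb h.1.symm
  have hmap : ∀ π ∈ S, F π ∈ T := by
    intro π _
    simp [T, F, π.injective.eq_iff]
  have := Finset.card_le_mul_card_image_of_maps_to hmap 6 (by
    intro t ht
    rcases Finset.eq_empty_or_nonempty (S.filter fun a => F a = t) with h | ⟨ρ, hρ⟩
    · rw [h]; simp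
    · have hρ' := hρ
      rw [Finset.mem_filter] at hρ'
      have : ((S.filter fun a => F a = t).image fun π => ρ⁻¹ * π).card ≤ 6 := by
        apply stab_card
        intro σ hσ
        rw [Finset.mem_image] at hσ
        obtain ⟨π, hπ, rfl⟩ := hσ
        rw [Finset.mem_filter] at hπ
        have hF : F π = F ρ := hπ.2.trans hρ'.2.symm
        simp only [F, Prod.mk.injEq] at hF
        refine ⟨aut_mul_inv G hA (by simpa [S] using hπ.1) (by simpa [S] using hρ'.1), ?_, ?_, ?_⟩
        · simp [hF.1]
        · simp [hF.2.1]
        · simp [hF.2.2]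
      rwa [Finset.card_image_of_injective _ (mul_right_injective _)] at this)
  rw [hT] at this
  exact this

end M11

namespace M11

theorem Hb_uniq : ∀ j j' : Fin 11, (∀ x y : Fin 12, (Hb j x = Hb j y ↔ Hb j' x = Hb j' y)) →
    j = j' := by
  decide +kernel

theorem faithful_aux : ∀ z : Fin 12, z ≠ 11 → ∃ x : Fin 12, ∀ w : Fin 12, ∃ j : Fin 11,
    ¬ (Hb j x = Hb j 11 ↔ Hb j w = Hb j z) := by
  decide +kernel

theorem faithful_aux2 : ∀ x w : Fin 12, (∀ j : Fin 11, (Hb j x = Hb j 11 ↔ Hb j w = Hb j 11)) →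
    x = w := by
  decide +kernel

theorem faithful (π : Equiv.Perm (Fin 12))
    (h : ∀ j : Fin 11, ∀ x y : Fin 12, (Hb j x = Hb j y ↔ Hb j (π x) = Hb j (π y))) : π = 1 := by
  have h11 : π 11 = 11 := by
    by_contra hne
    obtain ⟨x, hx⟩ := faithful_aux _ hne
    obtain ⟨j, hj⟩ := hx (π x)
    exact hj (h j x 11)
  ext x
  have := faithful_aux2 x (π x) (fun j => by
    have := h j x 11
    rw [h11] at this
    exact this)
  simp [← this]

def sFun (x : Fin 12) : Fin 12 := if x = 11 then 11 else if x = 10 then 0 else x + 1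
def sInv (x : Fin 12) : Fin 12 := if x = 11 then 11 else if x = 0 then 10 else x - 1

/-- the 11-cycle -/
def sP : Equiv.Perm (Fin 12) where
  toFun := sFun
  invFun := sInv
  left_inv := by decide +kernel
  right_inv := by decide +kernel

theorem sP_pow : sP ^ 11 = 1 := by
  ext x; revert x; decide +kernel

theorem sP_ne : sP ≠ 1 := by
  intro h
  have := congrArg (fun p : Equiv.Perm (Fin 12) => p 0) h
  revert this
  decide +kernel

instance : Fact (Nat.Prime 11) := ⟨by norm_num⟩

theorem sP_order : orderOf sP = 11 := orderOf_eq_prime sP_pow sP_ne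

def aff (c u : Fin 11) (x : Fin 12) : Fin 12 :=
  if x = 11 then 11 else Fin.ofNat 12 ((c + u * x : ℕ) % 11)

theorem aff_aut : ∀ c u : Fin 11, u ≠ 0 → u ∉ ([1, 3, 4, 5, 9] : List (Fin 11)) →
    ¬ (∃ j' : Fin 11, ∀ x y : Fin 12,
      (Hb 0 x = Hb 0 y ↔ Hb j' (aff c u x) = Hb j' (aff c u y))) := by
  decide +kernel

theorem sP_fix : ∀ x : Fin 12, sP x = x → x = 11 := by decide +kernel

theorem sP_pow_fix : ∀ k : Fin 11, (sP ^ (k : ℕ)) 11 = 11 := by decide +kernel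

theorem sP_aff : ∀ (k x : Fin 11) (y : Fin 12), ((sP ^ (k : ℕ)) ^ (x : ℕ)) y =
    if y = 11 then 11 else Fin.ofNat 12 ((y + k * x : ℕ) % 11) := by decide +kernel

theorem sP_gen : ∀ x : Fin 11, (sP ^ (x : ℕ)) 0 = Fin.castSucc x := by decide +kernel

/-- elements normalizing the 11-cycle -/
theorem norm_aff (π : Equiv.Perm (Fin 12)) (u : Fin 11) (hu : π * sP * π⁻¹ = sP ^ (u : ℕ)) :
    ∃ c : Fin 11, ∀ x, π x = aff c u x := by
  have hu0 : u ≠ 0 := by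
    rintro rfl
    simp at hu
    exact sP_ne hu
  have hmul : ∀ n : ℕ, π * sP ^ n = (sP ^ (u : ℕ)) ^ n * π := by
    intro n
    rw [← hu, conj_pow]; group
  have h11 : π 11 = 11 := by
    have h1 : π (sP (π⁻¹ 11)) = 11 := by
      have := congrArg (fun p : Equiv.Perm (Fin 12) => p 11) hu
      simp only [Equiv.Perm.mul_apply] at this
      rw [this, sP_pow_fix]
    have h2 : sP (π⁻¹ 11) = π⁻¹ 11 := by
      rw [Equiv.Perm.eq_inv_iff_eq]; exact h1
    have := sP_fix _ h2
    rw [Equiv.Perm.inv_eq_iff_eq] at this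
    exact this.symm
  have h0 : π 0 ≠ 11 := by
    intro h
    have := π.injective (h.trans h11.symm)
    exact absurd this (by decide)
  have hlt : ((π 0 : Fin 12) : ℕ) < 11 := by
    have := (π 0).isLt
    have : ((π 0 : Fin 12) : ℕ) ≠ 11 := fun hh => h0 (Fin.ext hh)
    omega
  refine ⟨⟨(π 0 : Fin 12), hlt⟩, fun x => ?_⟩
  by_cases hx : x = 11
  · simp [hx, h11, aff]
  · have hx' : (x : ℕ) < 11 := by
      have := x.isLt
      have : (x : ℕ) ≠ 11 := fun hh => hx (Fin.ext hh)
      omega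
    have h1 := congrArg (fun p : Equiv.Perm (Fin 12) => p 0) (hmul x)
    simp only [Equiv.Perm.mul_apply] at h1
    have h2 := sP_gen ⟨x, hx'⟩
    simp only at h2
    rw [h2] at h1
    have h3 : Fin.castSucc (⟨x, hx'⟩ : Fin 11) = x := Fin.ext rfl
    rw [h3] at h1
    rw [h1]
    have h4 := sP_aff u ⟨x, hx'⟩ (π 0)
    simp only at h4
    rw [h4, if_neg h0, aff, if_neg hx]

end M11

namespace M11
open Subgroup

theorem simple_abs (G : Type*) [Group G] [Finite G] (hc : Nat.card G = 7920)
    (hs : Nat.card (Sylow 11 G) = 144)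
    (hN : ∀ N : Subgroup G, N.Normal → N ≠ ⊥ → 11 ∣ Nat.card N) : IsSimpleGroup G := by
  have hnt : Nontrivial G := by
    rw [← Finite.one_lt_card_iff_nontrivial, hc]; norm_num
  refine ⟨fun N hNn => ?_⟩
  by_cases hb : N = ⊥
  · exact Or.inl hb
  right
  have h11 := hN N hNn hb
  have hmul := N.card_mul_index
  rw [hc] at hmul
  obtain ⟨P⟩ : Nonempty (Sylow 11 N) := inferInstance
  have hPc : Nat.card (P : Subgroup N) = 11 := by
    have h1 := P.card_eq_multiplicity
    rw [h1]
    have h2 : (Nat.card N).factorization 11 = 1 := by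
      apply le_antisymm
      · by_contra h
        push Not at h
        have : 11 ^ 2 ∣ Nat.card N := (Nat.Prime.pow_dvd_iff_le_factorization (by norm_num)
          Nat.card_pos.ne').2 h
        have : 11 ^ 2 ∣ 7920 := hmul ▸ Dvd.dvd.mul_right this _
        revert this; norm_num
      · exact (Nat.Prime.dvd_iff_one_le_factorization (by norm_num) Nat.card_pos.ne').1 h11
    rw [h2, pow_one]
  have hfac : (Nat.card G).factorization 11 = 1 := by
    rw [hc]
    apply le_antisymm
    · by_contra h
      push Not at h
      have : 11 ^ 2 ∣ 7920 := (Nat.Prime.pow_dvd_iff_le_factorization (by norm_num)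
        (by norm_num)).2 h
      revert this; norm_num
    · exact (Nat.Prime.dvd_iff_one_le_factorization (by norm_num) (by norm_num)).1 (by norm_num)
  have hmc : Nat.card ((P : Subgroup N).map N.subtype) = 11 := by
    refine Eq.trans ?_ hPc
    exact (Nat.card_congr ((P : Subgroup N).equivMapOfInjective N.subtype N.subtype_injective).toEquiv).symm
  let Q : Sylow 11 G := Sylow.ofCard ((P : Subgroup N).map N.subtype) (by rw [hmc, hfac, pow_one])
  have hQ : Nat.card (normalizer (((P : Subgroup N).map N.subtype : Subgroup G) : Set G)) = 55 := by
    have h1 := Q.card_eq_index_normalizer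
    rw [hs] at h1
    have h2 := (normalizer (Q : Set G)).card_mul_index
    rw [← h1, hc] at h2
    have : Nat.card (normalizer (Q : Set G)) = 55 := by omega
    exact this
  have hidx : N.index ∣ 55 := by
    have h1 := Sylow.normalizer_sup_eq_top P
    rw [← hQ, ← N.relIndex_top_right, ← h1]
    rw [relIndex_sup_right]
    exact relIndex_dvd_card _ _
  have hidx11 : ¬ 11 ∣ N.index := by
    intro h
    have : 11 * 11 ∣ 7920 := hmul ▸ mul_dvd_mul h11 h
    revert this; norm_num
  have hidx2 : N.index = 1 ∨ N.index = 5 := by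
    have hle := Nat.le_of_dvd (by norm_num) hidx
    generalize N.index = n at *
    interval_cases n <;> omega
  rcases hidx2 with h | h
  · exact index_eq_one.1 h
  exfalso
  rw [h] at hmul
  have hNc : Nat.card N = 1584 := by omega
  have hnorm : Nat.card (normalizer ((P : Subgroup N) : Set N)) = 11 := by
    have h1 : Nat.card (normalizer ((P : Subgroup N) : Set N)) ∣ 1584 := by
      rw [← hNc]; exact card_subgroup_dvd_card _
    have h2 : Nat.card (normalizer ((P : Subgroup N) : Set N)) ∣ 55 := by
      rw [← hQ]
      have e := Nat.card_congr ((normalizer ((P : Subgroup N) : Set N)).equivMapOfInjective N.subtype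
        N.subtype_injective).toEquiv
      rw [e]
      exact card_dvd_of_le (le_normalizer_map N.subtype)
    have h3 : Nat.card (normalizer ((P : Subgroup N) : Set N)) ∣ 11 := by
      have := Nat.dvd_gcd h1 h2
      norm_num at this
      exact this
    have h4 : 11 ∣ Nat.card (normalizer ((P : Subgroup N) : Set N)) := by
      have := card_dvd_of_le (le_normalizer (H := (P : Subgroup N)))
      rwa [hPc] at this
    exact Nat.dvd_antisymm h3 h4
  have hPn : (P : Subgroup N) = normalizer ((P : Subgroup N) : Set N) := by
    apply eq_of_le_of_card_ge le_normalizer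
    rw [hnorm, hPc]
  have hcomm : normalizer ((P : Subgroup N) : Set N) ≤ centralizer ((P : Subgroup N) : Set N) := by
    rw [← hPn]
    have : IsCyclic (P : Subgroup N) := isCyclic_of_prime_card hPc
    have : IsMulCommutative (P : Subgroup N) := inferInstance
    exact le_centralizer _
  have hcp := MonoidHom.ker_transferSylow_isComplement' P hcomm
  have hnd := MonoidHom.not_dvd_card_ker_transferSylow P hcomm
  set K := (MonoidHom.transferSylow P hcomm).ker with hK
  have hKc : Nat.card K = 144 := by
    have := hcp.card_mul_card
    rw [hPc, hNc] at this
    omega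
  have hKi : K.index = 11 := by
    have := K.card_mul_index
    rw [hKc, hNc] at this
    omega
  have hmem : ∀ g : N, g ∈ K ↔ g ^ 144 = 1 := by
    intro g
    constructor
    · intro hg
      have := pow_card_eq_one' (x := (⟨g, hg⟩ : K))
      rw [hKc] at this
      simpa using congrArg Subtype.val this
    · intro hg
      have h1 : g ^ 11 ∈ K := by
        rw [← hKi]; exact K.pow_index_mem g
      have h2 : g = (g ^ 144) * ((g ^ 11) ^ 13)⁻¹ := by
        rw [← pow_mul]; norm_num
        rw [eq_mul_inv_iff_mul_eq]
        exact (pow_succ' g 143).symm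
      rw [h2, hg, one_mul]
      exact inv_mem (pow_mem h1 _)
  have hKn : (K.map N.subtype).Normal := by
    refine ⟨fun n hn g => ?_⟩
    obtain ⟨k, hk, rfl⟩ := hn
    refine ⟨⟨g * k * g⁻¹, hNn.conj_mem _ k.2 g⟩, ?_, rfl⟩
    have hk' := (hmem k).1 hk
    refine (hmem _).2 ?_
    apply Subtype.ext
    simp only [SubmonoidClass.mk_pow, conj_pow, OneMemClass.coe_one]
    have : (k : G) ^ 144 = 1 := by simpa using congrArg Subtype.val hk'
    rw [this]; simp
  have hKcc : Nat.card (K.map N.subtype) = 144 := by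
    rw [← hKc]
    exact (Nat.card_congr (K.equivMapOfInjective N.subtype N.subtype_injective).toEquiv).symm
  have := hN _ hKn (by
    intro hb
    rw [hb] at hKcc
    simp at hKcc)
  rw [hKcc] at this
  revert this; norm_num
end M11

namespace M11
open Subgroup

theorem sP_act : ∀ j : Fin 11, ∀ x y : Fin 12, (Hb (0 : Fin 11) x = Hb (0 : Fin 11) y ↔
    Hb j ((sP ^ (j : ℕ)) x) = Hb j ((sP ^ (j : ℕ)) y)) := by decide +kernel

noncomputable def blk (G : Subgroup (Equiv.Perm (Fin 12))) (hA : ∀ π ∈ G, Aut π) (g : G)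
    (j : Fin 11) : Fin 11 := (hA g g.2 j).choose

theorem blk_spec (G : Subgroup (Equiv.Perm (Fin 12))) (hA : ∀ π ∈ G, Aut π) (g : G)
    (j : Fin 11) (x y : Fin 12) : (Hb j x = Hb j y ↔
      Hb (blk G hA g j) ((g : Equiv.Perm (Fin 12)) x) =
        Hb (blk G hA g j) ((g : Equiv.Perm (Fin 12)) y)) :=
  (hA g g.2 j).choose_spec x y

theorem blk_uniq (G : Subgroup (Equiv.Perm (Fin 12))) (hA : ∀ π ∈ G, Aut π) (g : G)
    (j j' : Fin 11) (h : ∀ x y : Fin 12, (Hb j x = Hb j y ↔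
      Hb j' ((g : Equiv.Perm (Fin 12)) x) = Hb j' ((g : Equiv.Perm (Fin 12)) y))) :
    blk G hA g j = j' := by
  apply Hb_uniq
  intro x y
  have h1 := blk_spec G hA g j ((g : Equiv.Perm (Fin 12))⁻¹ x) ((g : Equiv.Perm (Fin 12))⁻¹ y)
  have h2 := h ((g : Equiv.Perm (Fin 12))⁻¹ x) ((g : Equiv.Perm (Fin 12))⁻¹ y)
  have e : ∀ z, (g : Equiv.Perm (Fin 12)) ((g : Equiv.Perm (Fin 12))⁻¹ z) = z := fun z =>
    Equiv.apply_symm_apply _ z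
  simp only [e] at h1 h2
  rw [← h1, h2]

/-- action on blocks -/
@[reducible] noncomputable def blkAct (G : Subgroup (Equiv.Perm (Fin 12))) (hA : ∀ π ∈ G, Aut π) :
    MulAction G (Fin 11) where
  smul g j := blk G hA g j
  one_smul j := blk_uniq G hA 1 j j (fun x y => by simp)
  mul_smul g h j := blk_uniq G hA (g * h) j _ (fun x y => by
    rw [blk_spec G hA h j x y, blk_spec G hA g (blk G hA h j)]
    rfl)

theorem dvd_normal (G : Subgroup (Equiv.Perm (Fin 12))) (hA : ∀ π ∈ G, Aut π) (hs : sP ∈ G)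
    (N : Subgroup G) (hN : N.Normal) (hb : N ≠ ⊥) : 11 ∣ Nat.card N := by
  let _ := blkAct G hA
  have hsm : ∀ (g : G) (j : Fin 11), g • j = blk G hA g j := fun _ _ => rfl
  have htr : MulAction.IsPretransitive G (Fin 11) := by
    have h0 : ∀ j : Fin 11, (⟨sP ^ (j : ℕ), pow_mem hs _⟩ : G) • (0 : Fin 11) = j := fun j =>
      blk_uniq G hA _ _ _ (sP_act j)
    refine ⟨fun i j => ⟨(⟨sP ^ (j : ℕ), pow_mem hs _⟩ : G) *
      (⟨sP ^ (i : ℕ), pow_mem hs _⟩ : G)⁻¹, ?_⟩⟩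
    have h1 := h0 i
    rw [mul_smul]
    have h2 : (⟨sP ^ (i : ℕ), pow_mem hs _⟩ : G)⁻¹ • i = 0 := by
      rw [inv_smul_eq_iff, h1]
    rw [h2, h0 j]
  have hprim : MulAction.IsPreprimitive G (Fin 11) :=
    MulAction.IsPreprimitive.of_prime_card (by simp; norm_num)
  have hfix : MulAction.fixedPoints N (Fin 11) ≠ ⊤ := by
    intro h
    apply hb
    rw [eq_bot_iff]
    intro g hg
    have h1 : ∀ j : Fin 11, blk G hA g j = j := by
      intro j
      have : j ∈ MulAction.fixedPoints N (Fin 11) := by rw [h]; trivial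
      exact this ⟨g, hg⟩
    have h2 : (g : Equiv.Perm (Fin 12)) = 1 := by
      apply faithful
      intro j x y
      have := blk_spec G hA g j x y
      rwa [h1] at this
    rw [mem_bot]
    exact Subtype.ext h2
  have hNt : MulAction.IsPretransitive N (Fin 11) :=
    MulAction.IsQuasiPreprimitive.isPretransitive_of_normal hfix
  have h1 := MulAction.index_stabilizer_of_transitive N (0 : Fin 11)
  simp at h1
  rw [← h1]
  exact index_dvd_card _

theorem aff5 : ∀ c : Fin 11, ∀ u ∈ ([1, 3, 4, 5, 9] : List (Fin 11)), ∃ c' : Fin 11, ∀ x,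
    aff c u (aff c u (aff c u (aff c u (aff c u x)))) = aff c' 1 x := by decide +kernel

theorem aff11 : ∀ c x, (aff c 1)^[11] x = x := by decide +kernel

theorem compl_abs (G : Type*) [Group G] [Finite G] (P : Sylow 11 G)
    (hP : Nat.card (P : Subgroup G) = 11)
    (hn : Nat.card (normalizer ((P : Subgroup G) : Set G)) = 11)
    (hN : ∀ N : Subgroup G, N.Normal → N ≠ ⊥ → 11 ∣ Nat.card N) : Nat.card G = 11 := by
  have hPn : (P : Subgroup G) = normalizer ((P : Subgroup G) : Set G) := by
    apply eq_of_le_of_card_ge le_normalizer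
    rw [hn, hP]
  have hcomm : normalizer ((P : Subgroup G) : Set G) ≤ centralizer ((P : Subgroup G) : Set G) := by
    rw [← hPn]
    have : IsCyclic (P : Subgroup G) := isCyclic_of_prime_card hP
    have : IsMulCommutative (P : Subgroup G) := inferInstance
    exact le_centralizer _
  have hcp := MonoidHom.ker_transferSylow_isComplement' P hcomm
  have hnd := MonoidHom.not_dvd_card_ker_transferSylow P hcomm
  have hb : (MonoidHom.transferSylow P hcomm).ker = ⊥ := by
    by_contra h
    exact hnd (hN _ inferInstance h)
  have := hcp.card_mul_card
  rw [hP, hb] at this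
  simpa using this.symm

theorem m11_main (G : Subgroup (Equiv.Perm (Fin 12))) (hA : ∀ π ∈ G, Aut π) (hs : sP ∈ G)
    (hd : 264 ∣ Nat.card G) : Nat.card G = 7920 ∧ IsSimpleGroup G := by
  have hle := card_le G hA
  obtain ⟨k, hk⟩ := hd
  have hpos : 0 < Nat.card G := Nat.card_pos
  have hk6 : k ≤ 30 := by omega
  have hk1 : 1 ≤ k := by omega
  have hfac : (Nat.card G).factorization 11 = 1 := by
    apply le_antisymm
    · by_contra h
      push Not at h
      have : 11 ^ 2 ∣ Nat.card G := (Nat.Prime.pow_dvd_iff_le_factorization (by norm_num)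
        hpos.ne').2 h
      have h2 := this.trans (card_subgroup_dvd_card G)
      rw [Nat.card_eq_fintype_card, Fintype.card_perm] at h2
      revert h2
      decide
    · exact (Nat.Prime.dvd_iff_one_le_factorization (by norm_num) hpos.ne').1 (by omega)
  let s : G := ⟨sP, hs⟩
  have hso : orderOf s = 11 := by
    rw [← sP_order]; exact (orderOf_injective G.subtype G.subtype_injective s).symm
  have hzc : Nat.card (zpowers s) = 11 := by rw [Nat.card_zpowers, hso]
  let P : Sylow 11 G := Sylow.ofCard (zpowers s) (by rw [hzc, hfac, pow_one])
  have h1 := P.card_eq_index_normalizer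
  have h2 := card_sylow_modEq_one 11 G
  have h3 := (normalizer (P : Set G)).card_mul_index
  rw [← h1, hk] at h3
  have h4 : 11 ∣ Nat.card (normalizer (P : Set G)) := by
    have := card_dvd_of_le (le_normalizer (H := (P : Subgroup G)))
    have e : Nat.card (P : Subgroup G) = 11 := hzc
    rwa [e] at this
  have key : ∀ g : normalizer (P : Set G), ∃ cu : Fin 11 × {u : Fin 11 // u ∈ ([1, 3, 4, 5, 9] : List (Fin 11))},
      ∀ x, ((g : G) : Equiv.Perm (Fin 12)) x = aff cu.1 cu.2 x := by
    intro g
    have hg : (g : G) ∈ normalizer ((P : Subgroup G) : Set G) := g.2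
    rw [mem_normalizer_iff] at hg
    have hm : (g : G) * s * (g : G)⁻¹ ∈ zpowers s := (hg s).1 (mem_zpowers s)
    rw [mem_zpowers_iff_mem_range_orderOf, Finset.mem_image] at hm
    obtain ⟨u, hu, hu2⟩ := hm
    rw [hso, Finset.mem_range] at hu
    have hu3 : ((g : G) : Equiv.Perm (Fin 12)) * sP * ((g : G) : Equiv.Perm (Fin 12))⁻¹ =
      sP ^ ((⟨u, hu⟩ : Fin 11) : ℕ) := (congrArg Subtype.val hu2).symm
    obtain ⟨c, hc⟩ := norm_aff _ _ hu3
    have hu0 : (⟨u, hu⟩ : Fin 11) ≠ 0 := by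
      intro h
      rw [h] at hu3
      simp at hu3
      exact sP_ne hu3
    refine ⟨⟨c, ⟨⟨u, hu⟩, ?_⟩⟩, hc⟩
    by_contra hq
    apply aff_aut c ⟨u, hu⟩ hu0 hq
    obtain ⟨j', hj'⟩ := hA _ (g : G).2 0
    refine ⟨j', fun x y => ?_⟩
    have := hj' x y
    rw [hc, hc] at this
    exact this
  have h5 : Nat.card (normalizer (P : Set G)) ≤ 55 := by
    choose F hF using key
    have hinj : Function.Injective F := by
      intro a b hab
      apply Subtype.ext
      apply Subtype.ext
      ext x
      rw [hF, hF, hab]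
    have := Nat.card_le_card_of_injective F hinj
    refine this.trans (le_of_eq ?_)
    rw [Nat.card_prod]
    simp [Fintype.card_subtype]
    decide
  obtain ⟨m, hm⟩ := h4
  have hm5 : m ≤ 5 := by omega
  have h55 : ∀ g : normalizer (P : Set G), g ^ 55 = 1 := by
    intro g
    obtain ⟨⟨c, ⟨u, hu⟩⟩, hx⟩ := key g
    simp only at hx
    obtain ⟨c', hc'⟩ := aff5 c u hu
    apply Subtype.ext
    apply Subtype.ext
    ext x
    have e5 : ⇑((((g : G) : Equiv.Perm (Fin 12))) ^ 5) = aff c' 1 := by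
      funext x
      rw [← hc' x]
      simp only [pow_succ, pow_zero, one_mul, Equiv.Perm.mul_apply, hx]
    have : (((g ^ 55 : normalizer (P : Set G)) : G) : Equiv.Perm (Fin 12)) =
      ((((g : G) : Equiv.Perm (Fin 12))) ^ 5) ^ 11 := by
      rw [← pow_mul]; simp
    rw [this, Equiv.Perm.coe_pow, e5, aff11]
    simp
  have hpr : ∀ q : ℕ, q.Prime → q ∣ m → q = 5 ∨ q = 11 := by
    intro q hq hqm
    have : Fact q.Prime := ⟨hq⟩
    obtain ⟨g, hg⟩ := exists_prime_orderOf_dvd_card' (G := normalizer (P : Set G)) q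
      (hm ▸ Dvd.dvd.mul_left hqm _)
    have h6 : q ∣ 5 * 11 := by rw [← hg]; exact orderOf_dvd_of_pow_eq_one (h55 g)
    rcases (Nat.Prime.dvd_mul hq).1 h6 with h | h
    · exact Or.inl ((Nat.prime_dvd_prime_iff_eq hq (by norm_num)).1 h)
    · exact Or.inr ((Nat.prime_dvd_prime_iff_eq hq (by norm_num)).1 h)
  have hm0 : m ≠ 0 := by
    rintro rfl
    have : 0 < Nat.card (normalizer (P : Set G)) := Nat.card_pos
    omega
  have hm15 : m = 1 ∨ m = 5 := by
    have q2 := hpr 2 (by norm_num)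
    have q3 := hpr 3 (by norm_num)
    have n2 : ¬ 2 ∣ m := fun h => by have := q2 h; omega
    have n3 : ¬ 3 ∣ m := fun h => by have := q3 h; omega
    omega
  rcases hm15 with rfl | rfl
  · exfalso
    have := compl_abs G P hzc hm (fun N hN hb => dvd_normal G hA hs N hN hb)
    omega
  have hfin : k = 30 ∧ Nat.card (Sylow 11 G) = 144 := by
    rw [hm] at h3
    unfold Nat.ModEq at h2
    generalize Nat.card (Sylow 11 G) = n at *
    interval_cases k <;> omega
  have hc : Nat.card G = 7920 := by rw [hk, hfin.1]
  exact ⟨hc, simple_abs G hc hfin.2 (fun N hN hb => dvd_normal G hA hs N hN hb)⟩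

end M11

namespace M11

section B
variable {R : Type*} [CommRing R]

/-- evaluation of a coefficient list -/
def ev (x : R) : List ℤ → R
  | [] => 0
  | a :: l => (a : R) + x * ev x l

def addL : List ℤ → List ℤ → List ℤ
  | [], b => b
  | a :: l, [] => a :: l
  | a :: l, b :: m => (a + b) :: addL l m

def smulL (c : ℤ) (l : List ℤ) : List ℤ := l.map (c * ·)

def subL (a b : List ℤ) : List ℤ := addL a (smulL (-1) b)

def modL (p : ℤ) (l : List ℤ) : List ℤ := l.map (· % p)

def xm (fl l : List ℤ) : List ℤ :=
  if l.length = fl.length then addL (0 :: l.dropLast) (smulL (-(l.getLastD 0)) fl) else 0 :: l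

def mm (p : ℤ) (fl : List ℤ) : List ℤ → List ℤ → List ℤ
  | [], _ => []
  | a :: l, b => modL p (addL (smulL a b) (xm fl (mm p fl l b)))

def pw (p : ℤ) (fl : List ℤ) (l : List ℤ) : ℕ → List ℤ
  | 0 => [1]
  | n + 1 => mm p fl l (pw p fl l n)

def cmp (p : ℤ) (fl : List ℤ) (b : List ℤ) : List ℤ → List ℤ
  | [] => []
  | a :: l => addL [a] (mm p fl b (cmp p fl b l))

def zc (p : ℤ) (l : List ℤ) : Bool := l.all (fun a => a % p == 0)

def fr (p : ℤ) (fl : List ℤ) (q : ℕ) : ℕ → List ℤ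
  | 0 => [0, 1]
  | n + 1 => pw p fl (fr p fl q n) q

@[simp] theorem ev_nil (x : R) : ev x [] = 0 := rfl
@[simp] theorem ev_cons (x : R) (a : ℤ) (l : List ℤ) : ev x (a :: l) = a + x * ev x l := rfl

theorem ev_add (x : R) : ∀ a b : List ℤ, ev x (addL a b) = ev x a + ev x b
  | [], b => by simp [addL]
  | a :: l, [] => by simp [addL]
  | a :: l, b :: m => by simp [addL, ev_add x l m]; ring

theorem ev_smul (x : R) (c : ℤ) : ∀ a : List ℤ, ev x (smulL c a) = c * ev x a
  | [] => by simp [smulL]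
  | a :: l => by
    have := ev_smul x c l
    simp only [smulL, List.map_cons, ev_cons] at *
    rw [this]; push_cast; ring

theorem ev_sub (x : R) (a b : List ℤ) : ev x (subL a b) = ev x a - ev x b := by
  simp [subL, ev_add, ev_smul]; ring

theorem cast_mod {p : ℤ} (hp : (p : R) = 0) (a : ℤ) : ((a % p : ℤ) : R) = a := by
  have := Int.emod_add_mul_ediv a p
  conv_rhs => rw [← this]
  push_cast
  rw [hp]; ring

theorem ev_mod {p : ℤ} (hp : (p : R) = 0) (x : R) : ∀ a : List ℤ, ev x (modL p a) = ev x a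
  | [] => by simp [modL]
  | a :: l => by
    have := ev_mod hp x l
    simp only [modL, List.map_cons, ev_cons] at *
    rw [this, cast_mod hp]

theorem ev_append (x : R) : ∀ a b : List ℤ, ev x (a ++ b) = ev x a + x ^ a.length * ev x b
  | [], b => by simp
  | a :: l, b => by simp [ev_append x l b, pow_succ]; ring

theorem ev_xm (x : R) (fl l : List ℤ) (h : ev x fl + x ^ fl.length = 0) :
    ev x (xm fl l) = x * ev x l := by
  unfold xm
  split_ifs with hl
  · rcases List.eq_nil_or_concat l with rfl | ⟨m, c, rfl⟩
    · simp at hl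
      have : fl = [] := List.length_eq_zero_iff.1 hl.symm
      subst this
      simp [smulL, addL]
    · rw [ev_add, ev_smul, List.concat_eq_append]
      simp at hl
      simp [ev_append]
      have h' : ev x fl = - x ^ fl.length := by linear_combination h
      rw [h', ← hl, pow_succ]; ring
  · simp

theorem ev_mm {p : ℤ} (hp : (p : R) = 0) (x : R) (fl : List ℤ)
    (h : ev x fl + x ^ fl.length = 0) : ∀ a b : List ℤ, ev x (mm p fl a b) = ev x a * ev x b
  | [], b => by simp [mm]
  | a :: l, b => by
    rw [mm, ev_mod hp, ev_add, ev_smul, ev_xm x fl _ h, ev_mm hp x fl h l b, ev_cons]; ring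

theorem ev_pw {p : ℤ} (hp : (p : R) = 0) (x : R) (fl : List ℤ)
    (h : ev x fl + x ^ fl.length = 0) (l : List ℤ) : ∀ n, ev x (pw p fl l n) = ev x l ^ n
  | 0 => by simp [pw]
  | n + 1 => by rw [pw, ev_mm hp x fl h, ev_pw hp x fl h l n, pow_succ']

theorem ev_fr {p : ℤ} (hp : (p : R) = 0) (x : R) (fl : List ℤ)
    (h : ev x fl + x ^ fl.length = 0) (q : ℕ) : ∀ n, ev x (fr p fl q n) = x ^ (q ^ n)
  | 0 => by simp [fr]
  | n + 1 => by rw [fr, ev_pw hp x fl h, ev_fr hp x fl h q n, pow_succ, pow_mul]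

theorem ev_cmp {p : ℤ} (hp : (p : R) = 0) (x : R) (fl : List ℤ)
    (h : ev x fl + x ^ fl.length = 0) (b : List ℤ) : ∀ l, ev x (cmp p fl b l) = ev (ev x b) l
  | [] => by simp [cmp]
  | a :: l => by rw [cmp, ev_add, ev_mm hp x fl h, ev_cmp hp x fl h b l]; simp

theorem ev_zc {p : ℤ} (hp : (p : R) = 0) (x : R) : ∀ l : List ℤ, zc p l = true → ev x l = 0
  | [], _ => rfl
  | a :: l, h => by
    simp only [zc, List.all_cons, Bool.and_eq_true, beq_iff_eq] at h
    have h1 := ev_zc hp x l h.2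
    have h2 := cast_mod hp a
    rw [h.1] at h2
    simp [h1, ← h2]

theorem ev_map {S : Type*} [CommRing S] (φ : R →+* S) (x : R) :
    ∀ l : List ℤ, φ (ev x l) = ev (φ x) l
  | [] => by simp
  | a :: l => by simp [ev_map φ x l]

open Polynomial in
/-- the polynomial of a list -/
noncomputable def pl (R : Type*) [CommRing R] (l : List ℤ) : R[X] := ev (X : R[X]) l

theorem pl_eval (x : R) (l : List ℤ) : (pl R l).eval x = ev x l := by
  have := ev_map (Polynomial.evalRingHom x) (Polynomial.X : Polynomial R) l
  simpa [pl] using this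

theorem pl_aeval {S : Type*} [CommRing S] [Algebra R S] (x : S) (l : List ℤ) :
    Polynomial.aeval x (pl R l) = ev x l := by
  have := ev_map (Polynomial.aeval (R := R) x).toRingHom (Polynomial.X : Polynomial R) l
  simpa [pl] using this

theorem pl_coeff : ∀ (l : List ℤ) (n : ℕ), (pl R l).coeff n = ((l.getD n 0 : ℤ) : R)
  | [], n => by simp [pl]
  | a :: l, 0 => by simp [pl]
  | a :: l, n + 1 => by
    have := pl_coeff l n
    simp only [pl, ev_cons, Polynomial.coeff_add, Polynomial.coeff_X_mul] at *
    rw [this, ← Polynomial.C_eq_intCast, Polynomial.coeff_C_succ]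
    simp

theorem pl_natDegree (l : List ℤ) : (pl R l).natDegree ≤ l.length - 1 := by
  rw [Polynomial.natDegree_le_iff_coeff_eq_zero]
  intro n hn
  rw [pl_coeff, List.getD_eq_default]
  · simp
  · omega

end B
end M11

namespace M11
def fL : List ℤ := [-448,-4992,-20544,-19072,6768,-960,9696,4032,2556,872,204,24]
def gL : List ℤ := [-8445,-18593,3303,11747,-842,-3130,170,430,-19,-31,1]
def fD : List ℤ := [-4992,-41088,-57216,27072,-4800,58176,28224,20448,7848,2040,264,12]
def gD : List ℤ := [-18593,6606,35241,-3368,-15650,1020,3010,-152,-279,10,11]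
def gamL : List (List ℤ) := [
  [274087778159538965088, 742427382293692037856, -857695726088424065376, -386937019063682721728,
    647835813020951360256, 25590094393992280896, -159345187969900504384, 3518737585422219392,
    18443603293166231392, -597754973457949152, -954419484191732640],
  [485114958214236877536, 1261926052882962752064, 121792916648443371744, -442881535451664406272,
    797245818697570935840, -306115716623607597728, -229772508158658896928, 65535620242918065024,
    39897307737436084224, -4873728657136462560, -2689673408632566656],
  [-193852254362915419920, -1239777828606975220656, -1605932006177958337008, 813326653419456339872,
    1098361343432734518912, -695179105787350038432, -178689408966990054368, 110576487508505415616,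
    30745694383428926768, -6788348233501404624, -1970153290222275024],
  [-235392615200139664032, -147022238794569301344, 961200933506415257280, -26880000351906925280,
    -471850538179451339280, 209442222203932038992, 68778259031219649200, -36999098965057181920,
    -10817038401908617136, 2381112424090226544, 678902882060849552],
  [-597818967115889934576, -1406025120265532587824, 253812569741189427504, 813264789692859955168,
    -187905132696634239456, -241904691454920928064, 64327629553715658176, 28108056149861697152,
    -5548705391245432400, -1298423776736414640, 224144541228459952],
  [-224267626515571009632, -320504802200152206000, 692170262092985088288, 85606451204418677120,
    -578692522234964870736, 211849398270473103760, 116524766391859552048, -40186128703131856544,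
    -18340310318303067952, 2740709400839225760, 1163069949128159152],
  [-144027329407765126920, -261089005817469464616, 303888923867156992872, 114012531797217257360,
    -264018455689951812528, 66090544194467177408, 56239399681247017696, -14254535672432912480,
    -8391230757369708952, 1031089476854962488, 517956702526188200],
  [-34449634168904571336, -47382689458669332216, 151570612614739799976, 2261071069195851952,
    -141972806440946885592, 60179305390233072536, 28686206008465637624, -10996558526832127648,
    -4658045583553791680, 734488321885800864, 299309480297712752],
  [-3896668379085153066, -279044980717340130, 45388296660296853066, -8752317216481909244,
    -44733096315642692664, 22970798348687877340, 8818983095523991556, -4010206537309496872,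
    -1498367225677052066, 261142423247401098, 98237436264616942],
  [687770609229782874, 3559146376282331160, 9676898250855563802, -4217951235862515984,
    -9730504680070700910, 5956685808134789350, 1847048344248740022, -1001681087607389904,
    -329766995455473252, 63804581753217750, 22066021538898556],
  [187667403621266043, 678635766522915093, 1093637845002650877, -651290655914710558,
    -1097704128417259116, 743651325037806666, 202146472043928646, -122592829140113156,
    -37314918850499605, 7713508699490655, 2528969529588939],
  [10063164097377108, 33980751953527884, 44881724276668482, -30530557163061390,
    -44781565429324041, 31939726088139701, 8095410949101687, -5214712552616298,
    -1522445187843501, 326101003258905, 103885892168483]]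
def delL : List ℤ := [-9719484852531018679047677486263996495429632, -16424049205110704374160922219466369992228864, 14370585344487899769905613938641752422350848, 10756054743072507996244417893334260280983552,
    -6715623047011437364433660612525038069874688, -2486571421955806992757643313765936487464960, 1421101410369414892563304825747558128156672, 248676123213792278089798725120949141635072,
    -139083309023393713966870667532618568826880, -10565179773313682162403290604545397227520, 5528468558122165568447646504616417296384]
def v5 : List ℤ := [4,4,1,4,4,4,1,0,0,3,0,4]
def v7 : List ℤ := [6,1,6,6,5,3,0,2,3,2,4,3]
def hL : List ℤ := [6,1,3,6,6,1,0,1,4,1,3]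
def bL : List ℤ := [6,1,2,6,5,4,6,1,3,3,4]
def w1 : List ℤ := [4,5,6,4,2,0,1,2,1,3,1]
def w2 : List ℤ := [5,0,4,1,0,6,4,6,4,1,6]
def w3 : List ℤ := [3,5,1,0,0,4,1,2,2,5,5]
def rhoL : List ℤ := [5,0,0,5,3,5,0,6,6,0,3]
def w4 : List ℤ := [3,2,2,3,3,4,5,1,0,6,4]

section B2
variable {R : Type*} [CommRing R]

def ev2 (x y : R) : List (List ℤ) → R
  | [] => 0
  | a :: l => ev y a + x * ev2 x y l

def add2 : List (List ℤ) → List (List ℤ) → List (List ℤ)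
  | [], b => b
  | a :: l, [] => a :: l
  | a :: l, b :: m => addL a b :: add2 l m

def xm2 (fl : List ℤ) (l : List (List ℤ)) : List (List ℤ) :=
  if l.length = fl.length then
    add2 ([] :: l.dropLast) (fl.map fun c => smulL (-c) (l.getLastD [])) else [] :: l

def mm2 (fl gl : List ℤ) : List (List ℤ) → List (List ℤ) → List (List ℤ)
  | [], _ => []
  | a :: l, b => add2 (b.map (mm 0 gl a)) (xm2 fl (mm2 fl gl l b))

@[simp] theorem ev2_nil (x y : R) : ev2 x y [] = 0 := rfl
@[simp] theorem ev2_cons (x y : R) (a : List ℤ) (l) : ev2 x y (a :: l) = ev y a + x * ev2 x y l :=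
  rfl

theorem ev2_add (x y : R) : ∀ a b, ev2 x y (add2 a b) = ev2 x y a + ev2 x y b
  | [], b => by simp [add2]
  | a :: l, [] => by simp [add2]
  | a :: l, b :: m => by simp [add2, ev2_add x y l m, ev_add]; ring

theorem ev2_append (x y : R) : ∀ a b, ev2 x y (a ++ b) = ev2 x y a + x ^ a.length * ev2 x y b
  | [], b => by simp
  | a :: l, b => by simp [ev2_append x y l b, pow_succ]; ring

theorem ev2_smul (x y : R) (m : List ℤ) : ∀ fl : List ℤ,
    ev2 x y (fl.map fun c => smulL (-c) m) = - ev x fl * ev y m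
  | [] => by simp
  | a :: l => by simp [ev2_smul x y m l, ev_smul]; ring

theorem ev2_xm (x y : R) (fl : List ℤ) (l) (h : ev x fl + x ^ fl.length = 0) :
    ev2 x y (xm2 fl l) = x * ev2 x y l := by
  unfold xm2
  split_ifs with hl
  · rcases List.eq_nil_or_concat l with rfl | ⟨m, c, rfl⟩
    · simp at hl
      have : fl = [] := List.length_eq_zero_iff.1 hl.symm
      subst this
      simp [add2]
    · rw [ev2_add, ev2_smul, List.concat_eq_append]
      simp at hl
      simp [ev2_append]
      have h' : ev x fl = - x ^ fl.length := by linear_combination h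
      rw [h', ← hl, pow_succ]; ring
  · simp

theorem ev2_map (x y : R) (gl : List ℤ) (hg : ev y gl + y ^ gl.length = 0) (a : List ℤ) :
    ∀ b, ev2 x y (b.map (mm 0 gl a)) = ev y a * ev2 x y b
  | [] => by simp
  | c :: l => by
    simp only [List.map_cons, ev2_cons, ev2_map x y gl hg a l,
      ev_mm (p := 0) (by simp) y gl hg]; ring

theorem ev2_mm (x y : R) (fl gl : List ℤ) (h : ev x fl + x ^ fl.length = 0)
    (hg : ev y gl + y ^ gl.length = 0) : ∀ a b, ev2 x y (mm2 fl gl a b) = ev2 x y a * ev2 x y b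
  | [], b => by simp [mm2]
  | a :: l, b => by
    rw [mm2, ev2_add, ev2_map x y gl hg, ev2_xm x y fl _ h, ev2_mm x y fl gl h hg l b, ev2_cons]
    ring

theorem gam_chk : mm2 fL gL gamL gamL = delL :: List.replicate 11 (List.replicate 11 0) := by
  decide +kernel

theorem gam_sq (x y : R) (h : ev x fL + x ^ 12 = 0) (hg : ev y gL + y ^ 11 = 0) :
    ev2 x y gamL ^ 2 = ev y delL := by
  rw [pow_two, ← ev2_mm x y fL gL h hg, gam_chk]
  simp [List.replicate_succ]

theorem ev2_hom {S : Type*} [CommRing S] (φ : R →+* S) (x y : R) :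
    ∀ l, φ (ev2 x y l) = ev2 (φ x) (φ y) l
  | [] => by simp
  | a :: l => by simp [ev2_hom φ x y l, ev_map]

/-- substitute lists -/
def cmp2 (p : ℤ) (fl a b : List ℤ) : List (List ℤ) → List ℤ
  | [] => []
  | c :: l => addL (cmp p fl b c) (mm p fl a (cmp2 p fl a b l))

theorem ev_cmp2 {p : ℤ} (hp : (p : R) = 0) (z : R) (fl : List ℤ)
    (h : ev z fl + z ^ fl.length = 0) (a b : List ℤ) :
    ∀ l, ev z (cmp2 p fl a b l) = ev2 (ev z a) (ev z b) l
  | [] => by simp [cmp2]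
  | c :: l => by rw [cmp2, ev_add, ev_mm hp z fl h, ev_cmp hp z fl h, ev_cmp2 hp z fl h a b l]; simp

theorem c5_8 : zc 5 (subL (fr 5 fL 5 8) [0, 1]) = true := by decide +kernel
theorem c5_4 : zc 5 (subL (fr 5 fL 5 4) [0, 1]) = false := by decide +kernel
theorem s5 : zc 5 (subL (mm 5 fL v5 fD) [1]) = true := by decide +kernel
theorem s7 : zc 7 (subL (mm 7 fL v7 fD) [1]) = true := by decide +kernel
theorem c7_f : zc 7 (subL (fL ++ [1]) (0 :: (hL ++ [1]))) = true := by decide +kernel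
theorem c7_1 : zc 7 (subL (mm 7 hL w1 (subL (fr 7 hL 7 1) [0, 1])) [1]) = true := by decide +kernel
theorem c7_b : zc 7 (cmp 7 hL bL (gL ++ [1])) = true := by decide +kernel
theorem c7_b7 : zc 7 (subL (mm 7 hL w2 (subL (pw 7 hL bL 7) bL)) [1]) = true := by decide +kernel
theorem c7_bd : zc 7 (subL (mm 7 hL w3 (cmp 7 hL bL gD)) [1]) = true := by decide +kernel
theorem c7_rho : zc 7 (subL (mm 7 hL w4 (smulL 2 rhoL)) [1]) = true := by decide +kernel

end B2
end M11

namespace M11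
section B3
variable {R : Type*} [CommRing R]

def rowN (p a c : ℕ) : ℕ → List ℕ → List ℕ → List ℕ → List ℕ
  | r, b :: bs, t :: ts, n :: ns =>
    Nat.mod (Nat.add (Nat.add (Nat.mul a b) r) (Nat.mul c n)) p :: rowN p a c t bs ts ns
  | _, _, _, _ => []

def lastN : ℕ → List ℕ → ℕ
  | d, [] => d
  | _, a :: l => lastN a l

def mmN (p : ℕ) (nf : List ℕ) : List ℕ → List ℕ → List ℕ
  | [], _ => nf.map fun _ => 0
  | a :: l, b => rowN p a (lastN 0 (mmN p nf l b)) 0 b (mmN p nf l b) nf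

def evN (x : R) : List ℕ → R
  | [] => 0
  | a :: l => (a : R) + x * evN x l

@[simp] theorem evN_nil (x : R) : evN x [] = 0 := rfl
@[simp] theorem evN_cons (x : R) (a : ℕ) (l : List ℕ) : evN x (a :: l) = a + x * evN x l := rfl

theorem castN_mod {p : ℕ} (hp : (p : R) = 0) (a : ℕ) : ((Nat.mod a p : ℕ) : R) = a := by
  have := Nat.mod_add_div a p
  conv_rhs => rw [← this]
  push_cast
  rw [hp, zero_mul, add_zero]; rfl

theorem ev_rowN {p : ℕ} (hp : (p : R) = 0) (x : R) (a c : ℕ) : ∀ (bs ts ns : List ℕ) (r : ℕ),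
    bs.length = ns.length → ts.length = ns.length →
    evN x (rowN p a c r bs ts ns) + x ^ ns.length * lastN r ts =
      a * evN x bs + (r + x * evN x ts) + c * evN x ns
  | [], [], [], r, _, _ => by simp [rowN, lastN]
  | [], _ :: _, [], _, _, h => by simp at h
  | [], _ :: _, _ :: _, _, h, _ => by simp at h
  | _ :: _, [], [], _, h, _ => by simp at h
  | _ :: _, [], _ :: _, _, _, h => by simp at h
  | b :: bs, t :: ts, n :: ns, r, h1, h2 => by
    have h := ev_rowN hp x a c bs ts ns t (by simpa using h1) (by simpa using h2)
    simp only [rowN, lastN, evN_cons, List.length_cons, castN_mod hp]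
    simp only [Nat.add_eq, Nat.mul_eq]
    push_cast
    rw [pow_succ]
    linear_combination x * h

theorem len_rowN (p a c : ℕ) : ∀ (bs ts ns : List ℕ) (r : ℕ),
    bs.length = ns.length → ts.length = ns.length → (rowN p a c r bs ts ns).length = ns.length
  | [], [], [], r, _, _ => by simp [rowN]
  | [], _ :: _, [], _, _, h => by simp at h
  | [], _ :: _, _ :: _, _, h, _ => by simp at h
  | _ :: _, [], [], _, h, _ => by simp at h
  | _ :: _, [], _ :: _, _, _, h => by simp at h
  | b :: bs, t :: ts, n :: ns, r, h1, h2 => by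
    have h := len_rowN p a c bs ts ns t (by simpa using h1) (by simpa using h2)
    simp only [rowN, List.length_cons, h]

theorem len_mmN (p : ℕ) (nf b : List ℕ) (hb : b.length = nf.length) :
    ∀ a : List ℕ, (mmN p nf a b).length = nf.length
  | [] => by simp [mmN]
  | a :: l => len_rowN p a _ _ _ _ _ hb (len_mmN p nf b hb l)

theorem evN_zero (x : R) : ∀ nf : List ℕ, evN x (nf.map fun _ => 0) = 0
  | [] => rfl
  | a :: l => by
    have := evN_zero x l
    simp only [List.map_cons, evN_cons, this]; simp

theorem ev_mmN {p : ℕ} (hp : (p : R) = 0) (x : R) (nf : List ℕ) (hf : evN x nf = x ^ nf.length)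
    (b : List ℕ) (hb : b.length = nf.length) :
    ∀ a : List ℕ, evN x (mmN p nf a b) = evN x a * evN x b
  | [] => by simp only [mmN, evN_zero]; simp
  | a :: l => by
    have h := ev_rowN hp x a (lastN 0 (mmN p nf l b)) b (mmN p nf l b) nf 0 hb
      (len_mmN p nf b hb l)
    rw [mmN, evN_cons]
    rw [ev_mmN hp x nf hf b hb l, hf] at h
    push_cast at h
    linear_combination h

def nH : List ℕ := [1, 6, 4, 1, 1, 6, 0, 6, 3, 6, 4]

def p7 (l : List ℕ) : List ℕ :=
  mmN 7 nH (mmN 7 nH (mmN 7 nH (mmN 7 nH l l) l) (mmN 7 nH (mmN 7 nH l l) l)) l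

def frN : ℕ → List ℕ
  | 0 => [0, 1, 0, 0, 0, 0, 0, 0, 0, 0, 0]
  | n + 1 => p7 (frN n)

theorem c7_11 : frN 11 = frN 0 := by decide +kernel

def addN : List ℕ → List ℕ → List ℕ
  | [], b => b
  | a :: l, [] => a :: l
  | a :: l, b :: m => Nat.mod (Nat.add a b) 7 :: addN l m

def cmpN (a : List ℕ) : List (List ℕ) → List ℕ
  | [] => []
  | c :: l => addN c (mmN 7 nH (cmpN a l) a)

def bN : List ℕ := [6, 1, 2, 6, 5, 4, 6, 1, 3, 3, 4]
def rN : List ℕ := [5, 0, 0, 5, 3, 5, 0, 6, 6, 0, 3]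
def rN' : List ℕ := [2, 0, 0, 2, 4, 2, 0, 1, 1, 0, 4]
def zN : List ℕ := [0, 0, 0, 0, 0, 0, 0, 0, 0, 0, 0]

def gamB (l : List ℤ) : List ℕ := cmpN bN (l.map fun a => [(a % 7).toNat])

def gamB' : List (List ℕ) := [[5, 0, 0, 5, 3, 5, 0, 6, 6, 0, 3],
  [4, 3, 4, 1, 3, 1, 0, 4, 1, 4, 6],
  [0, 0, 4, 3, 5, 0, 0, 6, 6, 0, 1],
  [0, 0, 5, 3, 6, 4, 0, 6, 1, 3, 5],
  [3, 4, 3, 2, 0, 2, 6, 1, 1, 4, 4],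
  [1, 5, 3, 2, 0, 0, 2, 1, 1, 3, 0],
  [3, 2, 4, 5, 6, 5, 6, 2, 2, 4, 5],
  [4, 1, 1, 4, 5, 4, 2, 6, 5, 5, 2],
  [0, 5, 2, 6, 3, 0, 3, 2, 1, 6, 4],
  [5, 1, 3, 3, 5, 5, 0, 1, 4, 6, 2],
  [0, 6, 6, 2, 4, 1, 5, 2, 2, 4, 2],
  [0, 3, 1, 3, 4, 4, 0, 1, 4, 2, 2]]
theorem gamB_eq : gamL.map gamB = gamB' := by decide +kernel

def chkN : ℕ → List ℕ → Bool
  | 0, _ => true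
  | n + 1, l => (cmpN l gamB' == if Hb 0 (10 - n) then rN else rN') && chkN n (p7 l)

theorem c7_gam : chkN 11 (frN 0) = true := by decide +kernel
theorem c7_gam0 : cmpN zN gamB' = rN := by decide +kernel

theorem ev_addN (h7 : (7 : R) = 0) (x : R) : ∀ a b, evN x (addN a b) = evN x a + evN x b
  | [], b => by simp [addN]
  | a :: l, [] => by simp [addN]
  | a :: l, b :: m => by
    simp only [addN, evN_cons, ev_addN h7 x l m, castN_mod (R := R) (p := 7) (by exact_mod_cast h7),
      Nat.add_eq]
    push_cast; ring

variable (h7 : (7 : R) = 0) (x : R) (hx : evN x nH = x ^ 11)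
include h7 hx

theorem ev_p7 (l : List ℕ) (hl : l.length = 11) : evN x (p7 l) = evN x l ^ 7 := by
  have h7' : ((7 : ℕ) : R) = 0 := by exact_mod_cast h7
  have h1 := len_mmN 7 nH l hl (mmN 7 nH l l)
  unfold p7
  rw [ev_mmN h7' x nH hx _ hl, ev_mmN h7' x nH hx _ h1, ev_mmN h7' x nH hx _ hl,
    ev_mmN h7' x nH hx _ hl]
  ring

omit h7 hx in
theorem len_p7 (l : List ℕ) (hl : l.length = 11) : (p7 l).length = 11 := len_mmN 7 nH l hl _

omit h7 hx in
theorem len_frN : ∀ n, (frN n).length = 11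
  | 0 => rfl
  | n + 1 => len_p7 _ (len_frN n)

theorem ev_frN : ∀ n, evN x (frN n) = x ^ 7 ^ n
  | 0 => by simp [frN]
  | n + 1 => by rw [frN, ev_p7 h7 x hx _ (len_frN n), ev_frN n, pow_succ 7 n, pow_mul]

theorem pow_7_11 : x ^ 7 ^ 11 = x := by
  rw [← ev_frN h7 x hx 11, c7_11, ev_frN h7 x hx 0]; simp

theorem ev_gamB (l : List ℤ) : evN x (gamB l) = ev (evN x bN) l := by
  unfold gamB
  induction l with
  | nil => simp [cmpN]
  | cons a l ih =>
    simp only [List.map_cons, cmpN, ev_addN h7]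
    have e : (((a % 7).toNat : ℕ) : R) = (a : R) := by
      have h1 : (((a % 7).toNat : ℕ) : ℤ) = a % 7 := Int.toNat_of_nonneg (Int.emod_nonneg _ (by norm_num))
      have h2 : (((a % 7).toNat : ℕ) : R) = ((((a % 7).toNat : ℕ) : ℤ) : R) := by push_cast; rfl
      rw [h2, h1, cast_mod (R := R) (p := 7) (by exact_mod_cast h7)]
    rw [ev_mmN (by exact_mod_cast h7) x nH hx bN rfl, ih]
    simp [e]; ring

theorem ev_cmpN (a : List ℕ) (ha : a.length = 11) (l : List (List ℤ)) :
    evN x (cmpN a (l.map gamB)) = ev2 (evN x a) (evN x bN) l := by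
  induction l with
  | nil => simp [cmpN]
  | cons c l ih =>
    simp only [List.map_cons, cmpN, ev_addN h7]
    rw [ev_mmN (by exact_mod_cast h7) x nH hx a ha, ih, ev_gamB h7 x hx, ev2_cons]; ring

theorem chk_imp (n : ℕ) : ∀ (m : ℕ) (l : List ℕ), n + m = 11 → l = frN m → chkN n l = true →
    ∀ i, m ≤ i → i < 11 → ev2 (x ^ 7 ^ i) (evN x bN) gamL =
      if Hb 0 i then evN x rN else evN x rN' := by
  induction n with
  | zero => intro m l h _ _ i h1 h2; omega
  | succ n ih =>
    intro m l hn hl hc i h1 h2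
    rw [chkN, Bool.and_eq_true, beq_iff_eq] at hc
    rcases Nat.eq_or_lt_of_le h1 with h | h
    · have hi : 10 - n = i := by omega
      subst h
      rw [← ev_frN h7 x hx m, ← hl, ← ev_cmpN h7 x hx l (by rw [hl, len_frN]), gamB_eq, hc.1, hi]
      split_ifs <;> rfl
    · exact ih (m + 1) (p7 l) (by omega) (by rw [hl, frN]) hc.2 i (by omega) h2

theorem gam_red (i : ℕ) (hi : i < 11) : ev2 (x ^ 7 ^ i) (evN x bN) gamL =
      if Hb 0 i then evN x rN else - evN x rN := by
  rw [chk_imp h7 x hx 11 0 (frN 0) (by norm_num) rfl c7_gam i (by omega) hi]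
  have : evN x rN' = - evN x rN := by
    rw [eq_neg_iff_add_eq_zero, ← ev_addN h7]
    have : addN rN' rN = zN := by decide
    rw [this]; simp [zN]
  rw [this]

theorem gam_red0 : ev2 (0 : R) (evN x bN) gamL = evN x rN := by
  rw [← c7_gam0, ← gamB_eq, ev_cmpN h7 x hx zN rfl]; simp [zN]

end B3
end M11

namespace M11
open NumberField

theorem frob (E : Type) [Field E] [NumberField E] [IsGalois ℚ E] (q : ℕ) (hq : q.Prime) :
    ∃ (k : Type) (_ : Field k) (φ : 𝓞 E →+* k) (σ : E ≃ₐ[ℚ] E), (q : k) = 0 ∧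
      ∀ x y : 𝓞 E, σ (x : E) = (y : E) → φ y = φ x ^ q := by
  have hinv : Algebra.IsInvariant ℤ (𝓞 E) (E ≃ₐ[ℚ] E) := by
    refine ⟨fun x hx => ?_⟩
    have h1 : ∀ g : E ≃ₐ[ℚ] E, g (x : E) = x := fun g => by
      exact congrArg (fun z : 𝓞 E => (z : E)) (hx g)
    obtain ⟨r, hr⟩ := (IsGalois.mem_range_algebraMap_iff_fixed (F := ℚ) (x : E)).2 h1
    have h2 : IsIntegral ℤ r := by
      rw [← isIntegral_algebraMap_iff (algebraMap ℚ E).injective, hr]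
      exact x.2
    obtain ⟨n, hn⟩ := IsIntegrallyClosed.isIntegral_iff.1 h2
    refine ⟨n, ?_⟩
    apply NumberField.RingOfIntegers.ext
    rw [← hr, ← hn]
    simp
  have hp : (Ideal.span {(q:ℤ)}).IsMaximal := by
    have : Prime (q:ℤ) := Nat.prime_iff_prime_int.1 hq
    exact PrincipalIdealRing.isMaximal_of_irreducible this.irreducible
  obtain ⟨Q, hQm, hQo⟩ := Ideal.exists_maximal_ideal_liesOver_of_isIntegral (S := 𝓞 E) (Ideal.span {(q:ℤ)})
  have hQ0 : Q ≠ ⊥ := by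
    intro h
    have := hQo.over
    rw [h] at this
    have h2 : (q:ℤ) ∈ (⊥ : Ideal (𝓞 E)).under ℤ := this ▸ Ideal.mem_span_singleton_self _
    simp [Ideal.under] at h2
    exact hq.ne_zero h2
  have hfin : Finite (𝓞 E ⧸ Q) := Ideal.finiteQuotientOfFreeOfNeBot Q hQ0
  obtain ⟨σ, hσ⟩ := IsArithFrobAt.exists_of_isInvariant ℤ (E ≃ₐ[ℚ] E) Q
  refine ⟨𝓞 E ⧸ Q, Ideal.Quotient.field Q, Ideal.Quotient.mk Q, σ, ?_, ?_⟩
  · have h2 : (q:ℤ) ∈ Q.under ℤ := hQo.over ▸ Ideal.mem_span_singleton_self _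
    have h3 : ((q:ℤ) : 𝓞 E) ∈ Q := by simpa [Ideal.under] using h2
    have := Ideal.Quotient.eq_zero_iff_mem.2 h3
    simpa using this
  · intro x y h
    have h4 : y = σ • x := by
      apply NumberField.RingOfIntegers.ext
      rw [← h]; rfl
    have h5 := AlgHom.IsArithFrobAt.mk_apply hσ x
    rw [← hQo.over] at h5
    have h6 : Nat.card (ℤ ⧸ Ideal.span {(q:ℤ)}) = q := by
      rw [Nat.card_congr (Int.quotientSpanEquivZMod (q:ℤ)).toEquiv]
      simp
    rw [h6] at h5
    rw [h4]
    exact h5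
end M11

namespace M11
open NumberField Polynomial

theorem pl_map {R S : Type*} [CommRing R] [CommRing S] (φ : R →+* S) (l : List ℤ) :
    (pl R l).map φ = pl S l := by
  have := ev_map (Polynomial.mapRingHom φ) (X : R[X]) l
  simpa [pl] using this

theorem pl_monic {R : Type*} [CommRing R] [Nontrivial R] (l : List ℤ) (_hl : l ≠ []) :
    (pl R (l ++ [1])).Monic ∧ (pl R (l ++ [1])).natDegree = l.length := by
  have hc : (pl R (l ++ [1])).coeff l.length = 1 := by
    rw [pl_coeff]; simp
  have hd : (pl R (l ++ [1])).natDegree = l.length := by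
    apply natDegree_eq_of_le_of_coeff_ne_zero
    · have := pl_natDegree (R := R) (l ++ [1]); simpa using this
    · rw [hc]; exact one_ne_zero
  exact ⟨by rw [Monic, leadingCoeff, hd, hc], hd⟩

theorem ev1 {R : Type*} [CommRing R] (x : R) (l : List ℤ) :
    ev x (l ++ [1]) = ev x l + x ^ l.length := by simp [ev_append]

theorem splits_int {E : Type} [Field E] [NumberField E] (l : List ℤ) (hl : l ≠ [])
    (h : ((pl ℚ (l ++ [1])).map (algebraMap ℚ E)).Splits) : (pl (𝓞 E) (l ++ [1])).Splits := by
  rw [pl_map] at h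
  apply Splits.of_splits_map_of_injective (i := algebraMap (𝓞 E) E)
    (FaithfulSMul.algebraMap_injective _ _)
  · rw [pl_map]; exact h
  · intro a ha
    rw [pl_map] at ha
    have h1 : ev a (l ++ [1]) = 0 := by
      rw [← pl_eval]; exact (mem_roots'.1 ha).2
    have h2 : IsIntegral ℤ a := by
      refine ⟨pl ℤ (l ++ [1]), (pl_monic l hl).1, ?_⟩
      have := pl_aeval (R := ℤ) a (l ++ [1])
      rw [aeval_def] at this
      rw [this, h1]
    exact ⟨⟨a, h2⟩, rfl⟩

section
variable {S k : Type*} [CommRing S] [IsDomain S] [Field k]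

theorem exRoot (φ : S →+* k) (l : List ℤ) (hl : l ≠ []) (h : (pl S (l ++ [1])).Splits) (z : S)
    (hz : ev (φ z) (l ++ [1]) = 0) : ∃ r : S, ev r (l ++ [1]) = 0 ∧ φ r = φ z := by
  have h1 := h.eval_eq_prod_roots_of_monic (pl_monic l hl).1 z
  rw [pl_eval] at h1
  have h2 := congrArg φ h1
  rw [ev_map, hz, map_multiset_prod, eq_comm, Multiset.prod_eq_zero_iff] at h2
  simp only [Multiset.map_map, Multiset.mem_map, Function.comp] at h2
  obtain ⟨r, hr, h3⟩ := h2
  refine ⟨r, ?_, ?_⟩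
  · rw [← pl_eval]; exact (mem_roots'.1 hr).2
  · rw [map_sub, sub_eq_zero] at h3; exact h3.symm

theorem sep (φ : S →+* k) (P : S[X]) (r s : S) (hr : P.eval r = 0) (hs : P.eval s = 0) (hne : r ≠ s)
    (h : φ r = φ s) : φ (P.derivative.eval r) = 0 := by
  obtain ⟨k, hk⟩ := P.binomExpansion r (s - r)
  rw [add_sub_cancel, hr, hs] at hk
  have h1 : (P.derivative.eval r + k * (s - r)) * (s - r) = 0 := by linear_combination -hk
  have h2 : P.derivative.eval r + k * (s - r) = 0 :=
    (mul_eq_zero.1 h1).resolve_right (sub_ne_zero.2 hne.symm)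
  have h3 := congrArg φ h2
  simpa [h] using h3

theorem fD_eq (R : Type*) [CommRing R] : (pl R (fL ++ [1])).derivative = pl R fD := by
  ext n
  rw [coeff_derivative, pl_coeff, pl_coeff]
  by_cases hn : n < 12
  · interval_cases n <;> simp [fL, fD] <;> norm_num
  · rw [List.getD_eq_default, List.getD_eq_default]
    · simp
    · simp [fD]; omega
    · simp [fL]; omega

theorem fsep (φ : S →+* k) (q : ℤ) (v : List ℤ) (hq : (q : k) = 0) (hv : zc q (subL (mm q fL v fD) [1]) = true)
    (r s : S) (hr : ev r (fL ++ [1]) = 0) (hs : ev s (fL ++ [1]) = 0) (h : φ r = φ s) : r = s := by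
  by_contra hne
  have h1 := sep φ (pl S (fL ++ [1])) r s (by rw [pl_eval, hr]) (by rw [pl_eval, hs]) hne h
  rw [fD_eq, pl_eval, ev_map] at h1
  have h2 := ev_zc hq (φ r) _ hv
  have h3 : ev (φ r) (fL ++ [1]) = 0 := by rw [← ev_map, hr, map_zero]
  rw [ev_sub, ev_mm hq (φ r) fL (by rw [ev1] at h3; exact h3), h1] at h2
  simp at h2

theorem fnodup (φ : S →+* k) (q : ℤ)
    (v : List ℤ) (hq : (q : k) = 0) (hv : zc q (subL (mm q fL v fD) [1]) = true) :
    (pl S (fL ++ [1])).roots.Nodup := by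
  classical
  by_contra hn
  rw [Multiset.nodup_iff_count_le_one] at hn
  push Not at hn
  obtain ⟨r, hr⟩ := hn
  rw [count_roots, one_lt_rootMultiplicity_iff_isRoot (pl_monic fL (by simp [fL])).1.ne_zero] at hr
  obtain ⟨h0, h1⟩ := hr
  rw [IsRoot, fD_eq, pl_eval] at h1
  rw [IsRoot, pl_eval] at h0
  have h2 := ev_zc hq (φ r) _ hv
  have h3 : ev (φ r) (fL ++ [1]) = 0 := by rw [← ev_map, h0, map_zero]
  rw [ev_sub, ev_mm hq (φ r) fL (by rw [ev1] at h3; exact h3), ← ev_map _ r fD, h1] at h2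
  simp at h2

end
end M11

namespace M11
open NumberField Polynomial

theorem ev_smul_gal {E : Type} [Field E] [NumberField E] (τ : E ≃ₐ[ℚ] E) (r : 𝓞 E) (l : List ℤ) :
    τ • ev r l = ev (τ • r) l :=
  ev_map (MulSemiringAction.toRingHom (E ≃ₐ[ℚ] E) (𝓞 E) τ) r l

theorem frob_pow {E : Type} [Field E] [NumberField E] {k : Type} [Field k] (φ : 𝓞 E →+* k)
    (σ : E ≃ₐ[ℚ] E) (q : ℕ) (h : ∀ x y : 𝓞 E, σ (x : E) = (y : E) → φ y = φ x ^ q) (x : 𝓞 E) (n : ℕ) :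
    φ (σ ^ n • x) = φ x ^ q ^ n := by
  induction n with
  | zero => simp
  | succ n ih =>
    rw [pow_succ', mul_smul, h (σ ^ n • x) (σ • σ ^ n • x) rfl, ih, ← pow_mul, pow_succ]

theorem zc_of (k : Type*) [Field k] (q : ℕ) (hq : q.Prime) (h0 : (q : k) = 0) (l : List ℤ)
    (h : ∀ n, ((l.getD n 0 : ℤ) : k) = 0) : zc q l = true := by
  rw [zc, List.all_eq_true]
  intro a ha
  obtain ⟨n, hn, rfl⟩ := List.mem_iff_getElem.1 ha
  have h1 := h n
  rw [List.getD_eq_getElem _ _ hn] at h1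
  rw [beq_iff_eq]
  apply Int.emod_eq_zero_of_dvd
  by_contra hd
  obtain ⟨u, v, huv⟩ := (Int.prime_iff_natAbs_prime.2 (by simpa using hq) : Prime (q:ℤ)).coprime_iff_not_dvd.2 hd
  have := congrArg (fun z : ℤ => (z : k)) huv
  push_cast at this
  rw [h0, h1] at this
  simp at this

theorem len5 : (subL (fr 5 fL 5 4) [0, 1]).length = 12 := by decide +kernel

theorem frob5 {E : Type} [Field E] [NumberField E] [IsGalois ℚ E]
    (hf : (pl (𝓞 E) (fL ++ [1])).Splits) : ∃ σ : E ≃ₐ[ℚ] E,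
      (∀ r : 𝓞 E, ev r (fL ++ [1]) = 0 → σ ^ 8 • r = r) ∧
      ∃ r : 𝓞 E, ev r (fL ++ [1]) = 0 ∧ σ ^ 4 • r ≠ r := by
  obtain ⟨k, _, φ, σ, hk, h⟩ := frob E 5 (by norm_num)
  have hk' : ((5:ℤ):k) = 0 := by exact_mod_cast hk
  have hroot : ∀ r : 𝓞 E, ev r (fL ++ [1]) = 0 → ev (φ r) fL + φ r ^ fL.length = 0 := by
    intro r hr
    rw [← ev1, ← ev_map, hr, map_zero]
  refine ⟨σ, fun r hr => ?_, ?_⟩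
  · apply fsep φ 5 v5 hk' s5 _ _ _ hr
    · rw [frob_pow φ σ 5 h]
      have := ev_zc hk' (φ r) _ c5_8
      rw [ev_sub, ev_fr hk' _ _ (hroot r hr)] at this
      simp at this
      linear_combination this
    · rw [← ev_smul_gal, hr, smul_zero]
  · by_contra hcon
    push Not at hcon
    have hnd := fnodup (S := 𝓞 E) φ 5 v5 hk' s5
    have hcard : (pl (𝓞 E) (fL ++ [1])).roots.card = 12 := by
      rw [← hf.natDegree_eq_card_roots, (pl_monic fL (by simp [fL])).2]; rfl
    have hp : pl k (subL (fr 5 fL 5 4) [0, 1]) = 0 := by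
      classical
      let s := (pl (𝓞 E) (fL ++ [1])).roots.toFinset.image φ
      have hs : s.card = 12 := by
        rw [Finset.card_image_of_injOn, Multiset.toFinset_card_of_nodup hnd, hcard]
        intro a ha b hb hab
        simp only [Finset.mem_coe, Multiset.mem_toFinset, mem_roots', IsRoot, pl_eval] at ha hb
        exact fsep φ 5 v5 hk' s5 _ _ ha.2 hb.2 hab
      apply eq_zero_of_natDegree_lt_card_of_eval_eq_zero' _ s
      · intro i hi
        obtain ⟨r, hr, rfl⟩ := Finset.mem_image.1 hi
        simp only [Multiset.mem_toFinset, mem_roots', IsRoot, pl_eval] at hr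
        rw [pl_eval, ev_sub, ev_fr hk' _ _ (hroot r hr.2), ← frob_pow φ σ 5 h, hcon r hr.2]
        simp
      · rw [hs]
        have := pl_natDegree (R := k) (subL (fr 5 fL 5 4) [0, 1])
        rw [len5] at this
        omega
    have := zc_of k 5 (by norm_num) hk (subL (fr 5 fL 5 4) [0, 1]) (fun n => by
      rw [← pl_coeff, hp, coeff_zero])
    exact absurd (this.symm.trans c5_4) (by simp)

end M11

namespace M11
open NumberField Polynomial

theorem pow7_inj {k : Type*} [Field k] (a : k) (h11 : a ^ 7 ^ 11 = a) (h1 : a ^ 7 ≠ a) (i j : ℕ)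
    (hi : i < 11) (hj : j < 11) (h : a ^ 7 ^ i = a ^ 7 ^ j) : i = j := by
  have hit : ∀ n, (fun x : k => x ^ 7)^[n] a = a ^ 7 ^ n := fun n => by
    rw [pow_iterate]
  have hm : Function.minimalPeriod (fun x : k => x ^ 7) a = 11 := by
    apply Function.minimalPeriod_eq_prime
    · rw [Function.IsPeriodicPt, Function.IsFixedPt, hit, h11]
    · exact h1
  have := Function.iterate_injOn_Iio_minimalPeriod (f := fun x : k => x ^ 7) (x := a)
  rw [hm] at this
  exact this hi hj (by simp only [hit]; exact h)

theorem surj_roots {S : Type*} [CommRing S] [IsDomain S] (l : List ℤ) (hl : l ≠ []) {n : ℕ}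
    (hn : l.length = n) (e : Fin n → S) (he : Function.Injective e)
    (hr : ∀ i, ev (e i) (l ++ [1]) = 0) (r : S) (h : ev r (l ++ [1]) = 0) : ∃ i, e i = r := by
  classical
  have hm := pl_monic (R := S) l hl
  have hsub : Finset.univ.image e ⊆ (pl S (l ++ [1])).roots.toFinset := by
    intro x hx
    obtain ⟨i, -, rfl⟩ := Finset.mem_image.1 hx
    rw [Multiset.mem_toFinset, mem_roots hm.1.ne_zero, IsRoot, pl_eval, hr]
  have heq := Finset.eq_of_subset_of_card_le hsub (by
    rw [Finset.card_image_of_injective _ he, Finset.card_univ, Fintype.card_fin, ← hn, ← hm.2]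
    exact (Multiset.toFinset_card_le _).trans (card_roots' _))
  have : r ∈ (pl S (l ++ [1])).roots.toFinset := by
    rw [Multiset.mem_toFinset, mem_roots hm.1.ne_zero, IsRoot, pl_eval, h]
  rw [← heq] at this
  obtain ⟨i, -, h⟩ := Finset.mem_image.1 this
  exact ⟨i, h⟩

theorem ev2_smul_gal {E : Type} [Field E] [NumberField E] (τ : E ≃ₐ[ℚ] E) (r s : 𝓞 E)
    (l : List (List ℤ)) : τ • ev2 r s l = ev2 (τ • r) (τ • s) l :=
  ev2_hom (MulSemiringAction.toRingHom (E ≃ₐ[ℚ] E) (𝓞 E) τ) r s l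

theorem sP_val : ∀ i : Fin 12, ((sP i : Fin 12) : ℕ) =
    if (i:ℕ) = 11 then 11 else if (i:ℕ) = 10 then 0 else (i:ℕ) + 1 := by
  decide +kernel

theorem frob7 {E : Type} [Field E] [NumberField E] [IsGalois ℚ E]
    (hf : (pl (𝓞 E) (fL ++ [1])).Splits) (hg : (pl (𝓞 E) (gL ++ [1])).Splits) :
    ∃ e : Fin 12 → 𝓞 E, Function.Injective e ∧ (∀ i, ev (e i) (fL ++ [1]) = 0) ∧
      (∀ r, ev r (fL ++ [1]) = 0 → ∃ i, e i = r) ∧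
      (∃ σ : E ≃ₐ[ℚ] E, ∀ i, σ • e i = e (sP i)) ∧
      ∀ (τ : E ≃ₐ[ℚ] E) (π : Equiv.Perm (Fin 12)), (∀ i, τ • e i = e (π i)) → Aut π := by
  obtain ⟨k, _, φ, σ, hk, h⟩ := frob E 7 (by norm_num)
  have hk' : ((7:ℤ):k) = 0 := by exact_mod_cast hk
  have hk7 : (7:k) = 0 := by exact_mod_cast hk
  have : Fact (Nat.Prime 7) := ⟨by norm_num⟩
  have : CharP k 7 := (CharP.charP_iff_prime_eq_zero (by norm_num)).2 hk
  have hfn : fL ≠ [] := by simp [fL]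
  have hgn : gL ≠ [] := by simp [gL]
  have hpow := frob_pow φ σ 7 h
  have hinj := fsep (S := 𝓞 E) φ 7 v7 hk' s7
  have hsm : ∀ (τ : E ≃ₐ[ℚ] E) (r : 𝓞 E) l, ev r l = 0 → ev (τ • r) l = 0 := by
    intro τ r l hr; rw [← ev_smul_gal, hr, smul_zero]
  have hfx : ∀ x : k, ev x (fL ++ [1]) = x * ev x (hL ++ [1]) := by
    intro x
    have := ev_zc hk' x _ c7_f
    rw [ev_sub, ev_cons] at this
    simp only [Int.cast_zero, zero_add] at this
    exact sub_eq_zero.1 this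
  obtain ⟨ri, hri, hri0⟩ := exRoot φ fL hfn hf 0 (by rw [hfx]; simp)
  rw [map_zero] at hri0
  -- another root
  obtain ⟨r0, hr0, hr0i⟩ : ∃ r0 : 𝓞 E, ev r0 (fL ++ [1]) = 0 ∧ r0 ≠ ri := by
    by_contra hcon
    push Not at hcon
    have hnd := fnodup (S := 𝓞 E) φ 7 v7 hk' s7
    have hcard : (pl (𝓞 E) (fL ++ [1])).roots.card = 12 := by
      rw [← hf.natDegree_eq_card_roots, (pl_monic fL (by simp [fL])).2]; rfl
    have : (pl (𝓞 E) (fL ++ [1])).roots ≤ {ri} := by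
      rw [Multiset.le_iff_subset hnd]
      intro x hx
      rw [mem_roots', IsRoot, pl_eval] at hx
      simp [hcon x hx.2]
    have := Multiset.card_le_card this
    rw [hcard] at this
    simp at this
  set a := φ r0 with ha
  have ha0 : a ≠ 0 := fun h0 => hr0i (hinj r0 ri hr0 hri (by rw [hri0, ← ha, h0]))
  have hha : ev a hL + a ^ 11 = 0 := by
    have : ev a (fL ++ [1]) = 0 := by rw [ha, ← ev_map, hr0, map_zero]
    rw [hfx] at this
    have := (mul_eq_zero.1 this).resolve_left ha0
    rw [ev1] at this; exact this
  have hN : evN a nH = a ^ 11 := by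
    simp only [hL, ev_cons, ev_nil] at hha
    simp only [nH, evN_cons, evN_nil]
    push_cast at hha ⊢
    linear_combination (-1) * hha + (1 + a + a^2+a^3+a^4+a^5+a^7+a^8+a^9+a^10) * hk7
  have h711 := pow_7_11 hk7 a hN
  have ha7 : a ^ 7 ≠ a := by
    intro hc
    have := ev_zc hk' a _ c7_1
    rw [ev_sub, ev_mm hk' a hL hha, ev_sub, ev_fr hk' a hL hha] at this
    simp [hc] at this
  have hbb : evN a bN = ev a bL := by
    simp [bN, bL]
  have hrr : evN a rN = ev a rhoL := by
    simp [rN, rhoL]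
  set b := ev a bL with hb
  have hb7 : b ^ 7 ≠ b := by
    intro hc
    have := ev_zc hk' a _ c7_b7
    rw [ev_sub, ev_mm hk' a hL hha, ev_sub, ev_pw hk' a hL hha, ← hb, hc] at this
    simp at this
  have hb711 : b ^ 7 ^ 11 = b := by
    have := ev_map (iterateFrobenius k 7 11) a bL
    rw [iterateFrobenius_def, iterateFrobenius_def, h711] at this
    exact this
  set ρ := ev a rhoL with hρ
  have hρ2 : ρ ≠ - ρ := by
    intro hc
    have := ev_zc hk' a _ c7_rho
    rw [ev_sub, ev_mm hk' a hL hha, ev_smul, ← hρ] at this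
    have h2 : ((2:ℤ):k) * ρ = 0 := by push_cast; linear_combination hc
    rw [h2] at this
    simp at this
  obtain ⟨β0, hβ0, hβb⟩ := exRoot φ gL hgn hg (ev r0 bL) (by
    rw [ev_map, ← ha, ← ev_cmp hk' a hL hha]; exact ev_zc hk' a _ c7_b)
  rw [ev_map, ← ha, ← hb] at hβb
  let β : Fin 11 → 𝓞 E := fun j => σ ^ (j:ℕ) • β0
  have hβi : Function.Injective β := by
    intro i j hij
    have := congrArg φ hij
    simp only [β, hpow, hβb] at this
    exact Fin.ext (pow7_inj b hb711 hb7 i j i.2 j.2 this)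
  have hβr : ∀ j, ev (β j) (gL ++ [1]) = 0 := fun j => hsm _ _ _ hβ0
  have hβs := surj_roots gL hgn (n := 11) rfl β hβi hβr
  let e : Fin 12 → 𝓞 E := fun i => if (i:ℕ) = 11 then ri else σ ^ (i:ℕ) • r0
  have hφe : ∀ i : Fin 12, φ (e i) = if (i:ℕ) = 11 then 0 else a ^ 7 ^ (i:ℕ) := by
    intro i
    simp only [e]
    split_ifs
    · exact hri0
    · rw [hpow]
  have hei : Function.Injective e := by
    intro i j hij
    have := congrArg φ hij
    rw [hφe, hφe] at this
    have hi := i.2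
    have hj := j.2
    apply Fin.ext
    split_ifs at this with h1 h2 h2
    · rw [h1, h2]
    · exact absurd this.symm (pow_ne_zero _ ha0)
    · exact absurd this (pow_ne_zero _ ha0)
    · exact pow7_inj a h711 ha7 i j (by omega) (by omega) this
  have her : ∀ i, ev (e i) (fL ++ [1]) = 0 := by
    intro i
    simp only [e]
    split_ifs
    · exact hri
    · exact hsm _ _ _ hr0
  have hes := surj_roots fL hfn (n := 12) rfl e hei her
  have hσe : ∀ i, σ • e i = e (sP i) := by
    intro i
    apply hinj _ _ (hsm _ _ _ (her i)) (her _)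
    have h1 := hpow (e i) 1
    rw [pow_one, pow_one] at h1
    rw [h1, hφe, hφe]
    rw [sP_val i]
    by_cases h11 : (i:ℕ) = 11
    · simp [h11]
    · by_cases h10 : (i:ℕ) = 10
      · simp only [h10]
        norm_num
        rw [← pow_mul]
        have := h711
        norm_num at this
        exact this
      · have := i.2
        rw [if_neg h11, if_neg h11, if_neg h10, if_neg (by omega), ← pow_mul, pow_succ]
  have hσen : ∀ (n : ℕ) i, σ ^ n • e i = e ((sP ^ n) i) := by
    intro n
    induction n with
    | zero => intro i; simp
    | succ n ih =>
      intro i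
      rw [pow_succ', mul_smul, ih, hσe, pow_succ', Equiv.Perm.mul_apply]
  have hγ0 : ∀ x : Fin 12, φ (ev2 (e x) β0 gamL) = if Hb 0 x then ρ else - ρ := by
    intro x
    rw [ev2_hom, hφe, hβb, ← hbb, ← hrr]
    split_ifs with h1 h2 h2
    · exact gam_red0 hk7 a hN
    · exact absurd (by rw [h1]; exact Hb_inf 0) h2
    · rw [gam_red hk7 a hN x (by have := x.2; omega), if_pos h2]
    · rw [gam_red hk7 a hN x (by have := x.2; omega), if_neg h2]
  have hsame0 : ∀ x y : Fin 12, ev2 (e x) β0 gamL = ev2 (e y) β0 gamL ↔ Hb 0 x = Hb 0 y := by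
    intro x y
    have hxx := hγ0 x
    have hyy := hγ0 y
    constructor
    · intro hxy
      rw [hxy, hyy] at hxx
      cases h1 : Hb 0 x <;> cases h2 : Hb 0 y <;> simp only [h1, h2] at hxx ⊢
      · exact absurd (by simpa using hxx) hρ2
      · exact absurd (by simpa using hxx.symm) hρ2
    · intro hxy
      have hq : ∀ z : Fin 12, ev2 (e z) β0 gamL ^ 2 = ev β0 delL := fun z =>
        gam_sq _ _ (by have := her z; rw [ev1] at this; exact this)
          (by have := hβ0; rw [ev1] at this; exact this)
      rcases sq_eq_sq_iff_eq_or_eq_neg.1 ((hq x).trans (hq y).symm) with h1 | h1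
      · exact h1
      · exfalso
        rw [h1, map_neg, hyy, hxy] at hxx
        split_ifs at hxx
        · exact hρ2 hxx.symm
        · exact hρ2 (by simpa using hxx)
  have hsame : ∀ (j : Fin 11) (x y : Fin 12),
      ev2 (e x) (β j) gamL = ev2 (e y) (β j) gamL ↔ Hb j x = Hb j y := by
    intro j x y
    obtain ⟨x', rfl⟩ := (sP ^ (j:ℕ)).surjective x
    obtain ⟨y', rfl⟩ := (sP ^ (j:ℕ)).surjective y
    rw [← hσen, ← hσen, ← ev2_smul_gal, ← ev2_smul_gal, smul_left_cancel_iff, hsame0]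
    have := sP_act j x' y'
    simpa using this
  refine ⟨e, hei, her, hes, ⟨σ, hσe⟩, ?_⟩
  intro τ π hπ j
  obtain ⟨j', hj'⟩ := hβs (τ • β j) (hsm _ _ _ (hβr j))
  refine ⟨j', fun x y => ?_⟩
  rw [← hsame, ← hsame, ← hπ, ← hπ, hj', ← ev2_smul_gal, ← ev2_smul_gal, smul_left_cancel_iff]

end M11

namespace M11
open NumberField Polynomial

theorem f0_eq : f0 = pl ℚ (fL ++ [1]) := by
  have h : (C (40:ℚ)) = (40 : ℚ[X]) := rfl
  rw [f0, h]
  simp only [pl, fL, List.cons_append, List.nil_append, ev_cons, ev_nil]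
  push_cast
  ring

theorem no_root5 : ∀ x : ZMod 5, ev x (fL ++ [1]) ≠ 0 := by
  have h : (((5:ℤ)) : ZMod 5) = 0 := rfl
  intro x
  rw [← ev_mod h]
  have : modL 5 (fL ++ [1]) = [2, 3, 1, 3, 3, 0, 1, 2, 1, 2, 4, 4, 1] := by decide +kernel
  rw [this]
  revert x
  simp only [ev_cons, ev_nil]
  decide

theorem no_rat_root (r : ℚ) : ev r (fL ++ [1]) ≠ 0 := by
  intro h
  have h2 : IsIntegral ℤ r := by
    refine ⟨pl ℤ (fL ++ [1]), (pl_monic fL (by simp [fL])).1, ?_⟩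
    have := pl_aeval (R := ℤ) r (fL ++ [1])
    rw [aeval_def] at this
    rw [this, h]
  obtain ⟨n, rfl⟩ := IsIntegrallyClosed.isIntegral_iff.1 h2
  have h3 : ev n (fL ++ [1]) = 0 := by
    have := ev_map (algebraMap ℤ ℚ) n (fL ++ [1])
    rw [h] at this
    simpa using this
  apply no_root5 (n : ZMod 5)
  have := ev_map (Int.castRingHom (ZMod 5)) n (fL ++ [1])
  rw [h3] at this
  simpa using this.symm

theorem deg_dvd_card (p : ℚ[X]) (p_irr : Irreducible p) (hd : p.natDegree ≠ 0) :
    p.natDegree ∣ Nat.card p.Gal := by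
  rw [Gal.card_of_separable p_irr.separable]
  have hp : p.degree ≠ 0 := fun h => hd (natDegree_eq_zero_iff_degree_le_zero.mpr (le_of_eq h))
  let α : p.SplittingField :=
    rootOfSplits (SplittingField.splits p) (by rwa [degree_map])
  have hα : IsIntegral ℚ α := .of_finite ℚ α
  use Module.finrank (IntermediateField.adjoin ℚ {α}) p.SplittingField
  suffices (minpoly ℚ α).natDegree = p.natDegree by
    rw [← Module.finrank_mul_finrank ℚ (IntermediateField.adjoin ℚ {α}) p.SplittingField,
      IntermediateField.adjoin.finrank hα, this]
  suffices minpoly ℚ α ∣ p by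
    have key := (minpoly.irreducible hα).dvd_symm p_irr this
    apply le_antisymm
    · exact natDegree_le_of_dvd this p_irr.ne_zero
    · exact natDegree_le_of_dvd key (minpoly.ne_zero hα)
  apply minpoly.dvd ℚ α
  rw [← eval_map_algebraMap]
  exact eval_rootOfSplits (SplittingField.splits p) (by rwa [degree_map])

theorem sP_inj : ∀ a b : Fin 11, (sP ^ (a:ℕ)) 0 = (sP ^ (b:ℕ)) 0 → a = b := by decide +kernel

theorem irr_of {E : Type} [Field E] [NumberField E] (e : Fin 12 → 𝓞 E)
    (he : Function.Injective e) (hr : ∀ i, ev (e i) (fL ++ [1]) = 0)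
    (σ : E ≃ₐ[ℚ] E) (hσ : ∀ i, σ • e i = e (sP i)) : Irreducible f0 := by
  classical
  have hm := pl_monic (R := ℚ) fL (by simp [fL])
  rw [← f0_eq] at hm
  set x : E := (e 0 : E) with hx
  have hxi : IsIntegral ℚ x := .of_finite ℚ x
  have hr' : ∀ i, ev (e i : E) (fL ++ [1]) = 0 := fun i => by
    have := ev_map (algebraMap (𝓞 E) E) (e i) (fL ++ [1])
    rw [hr] at this; simpa using this.symm
  have hdvd : minpoly ℚ x ∣ f0 := by
    apply minpoly.dvd
    rw [f0_eq, pl_aeval]; exact hr' 0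
  have hσ' : ∀ i, σ (e i : E) = e (sP i) := fun i =>
    congrArg (fun z : 𝓞 E => (z : E)) (hσ i)
  have hpw : ∀ n : ℕ, aeval (e ((sP ^ n) 0) : E) (minpoly ℚ x) = 0 := by
    intro n
    induction n with
    | zero => exact minpoly.aeval ℚ x
    | succ n ih =>
      rw [pow_succ', Equiv.Perm.mul_apply, ← hσ']
      rw [show σ (e ((sP ^ n) 0) : E) = (σ : E →ₐ[ℚ] E) (e ((sP ^ n) 0) : E) from rfl, aeval_algHom_apply, ih, map_zero]
  have h11 : 11 ≤ (minpoly ℚ x).natDegree := by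
    obtain ⟨u, hu, hur⟩ : ∃ u : Fin 11 → E, Function.Injective u ∧
        ∀ n, aeval (u n) (minpoly ℚ x) = 0 := by
      refine ⟨fun n => (e ((sP ^ (n:ℕ)) 0) : E), ?_, fun n => hpw n⟩
      intro a b hab
      exact sP_inj a b (he (RingOfIntegers.ext hab))
    have hs : (Finset.univ.image u).card = 11 := by
      rw [Finset.card_image_of_injective _ hu, Finset.card_univ, Fintype.card_fin]
    rw [← hs]
    have hsub : (Finset.univ.image u).val ⊆ ((minpoly ℚ x).map (algebraMap ℚ E)).roots := by
      intro z hz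
      rw [Finset.mem_val, Finset.mem_image] at hz
      obtain ⟨n, -, rfl⟩ := hz
      rw [mem_roots (map_ne_zero (minpoly.ne_zero hxi)), IsRoot, eval_map_algebraMap]
      exact hur n
    have h := card_le_degree_of_subset_roots hsub
    rwa [natDegree_map] at h
  obtain ⟨q, hq⟩ := hdvd
  have hmm := minpoly.monic hxi
  have hqm : q.Monic := hmm.of_mul_monic_left (hq ▸ hm.1)
  have hdeg : (minpoly ℚ x).natDegree + q.natDegree = 12 := by
    rw [← hmm.natDegree_mul hqm, ← hq, hm.2]; rfl
  have hq0 : q.natDegree = 0 := by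
    by_contra h0
    have h1 : q.natDegree = 1 := by omega
    have h2 : q.degree = 1 := by rw [degree_eq_natDegree hqm.ne_zero, h1]; rfl
    obtain ⟨r, hr⟩ := exists_root_of_degree_eq_one h2
    apply no_rat_root r
    rw [← pl_eval, ← f0_eq, hq, eval_mul, hr, mul_zero]
  rw [hqm.natDegree_eq_zero.1 hq0, mul_one] at hq
  rw [hq]
  exact minpoly.irreducible hxi

theorem gal_aux {E : Type} [Field E] [NumberField E] [IsGalois ℚ E]
    (hs : ((f0 * pl ℚ (gL ++ [1])).map (algebraMap ℚ E)).Splits) :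
    Irreducible f0 ∧ IsSimpleGroup f0.Gal ∧ Nat.card f0.Gal = 7920 := by
  have hmf := pl_monic (R := ℚ) fL (by simp [fL])
  have hmg := pl_monic (R := ℚ) gL (by simp [gL])
  have hP : f0 * pl ℚ (gL ++ [1]) ≠ 0 := mul_ne_zero (f0_eq ▸ hmf.1.ne_zero) hmg.1.ne_zero
  have hPE : (f0 * pl ℚ (gL ++ [1])).map (algebraMap ℚ E) ≠ 0 := map_ne_zero hP
  have hf0 : (f0.map (algebraMap ℚ E)).Splits :=
    hs.of_dvd hPE (Polynomial.map_dvd _ (dvd_mul_right _ _))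
  have hg0 : ((pl ℚ (gL ++ [1])).map (algebraMap ℚ E)).Splits :=
    hs.of_dvd hPE (Polynomial.map_dvd _ (dvd_mul_left _ _))
  have hf := splits_int (E := E) fL (by simp [fL]) (f0_eq ▸ hf0)
  have hg := splits_int (E := E) gL (by simp [gL]) hg0
  obtain ⟨e, hei, her, hes, ⟨σ, hσ⟩, hA⟩ := frob7 hf hg
  obtain ⟨σ5, h8, r5, hr5, h4⟩ := frob5 hf
  have hirr := irr_of e hei her σ hσ
  have : Fact ((f0.map (algebraMap ℚ E)).Splits) := ⟨hf0⟩
  have hne : f0 ≠ 0 := hirr.ne_zero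
  have hev : ∀ x : 𝓞 E, ev (x : E) (fL ++ [1]) = 0 ↔ ev x (fL ++ [1]) = 0 := fun x => by
    have := ev_map (algebraMap (𝓞 E) E) x (fL ++ [1])
    rw [← this]
    exact map_eq_zero_iff _ (FaithfulSMul.algebraMap_injective _ _)
  have hmem : ∀ i, (e i : E) ∈ f0.rootSet E := fun i => by
    rw [mem_rootSet]
    refine ⟨hne, ?_⟩
    rw [f0_eq, pl_aeval]
    exact (hev _).2 (her i)
  let e' : Fin 12 ≃ f0.rootSet E := Equiv.ofBijective (fun i => ⟨(e i : E), hmem i⟩) (by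
    constructor
    · intro i j hij
      exact hei (RingOfIntegers.ext (congrArg (fun z : f0.rootSet E => (z : E)) hij))
    · rintro ⟨x, hx⟩
      rw [mem_rootSet, f0_eq, pl_aeval] at hx
      have hxi : IsIntegral ℤ x := by
        refine ⟨pl ℤ (fL ++ [1]), (pl_monic fL (by simp [fL])).1, ?_⟩
        have := pl_aeval (R := ℤ) x (fL ++ [1])
        rw [aeval_def] at this
        rw [this, hx.2]
      obtain ⟨i, hi⟩ := hes ⟨x, hxi⟩ ((hev _).1 hx.2)
      exact ⟨i, Subtype.ext (by simp only [hi]; rfl)⟩)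
  let ψ : f0.Gal →* Equiv.Perm (Fin 12) :=
    (e'.symm.permCongrHom : Equiv.Perm (f0.rootSet E) ≃* Equiv.Perm (Fin 12)).toMonoidHom.comp
      (Gal.galActionHom f0 E)
  have hψi : Function.Injective ψ := by
    intro a b hab
    exact Gal.galActionHom_injective f0 E ((e'.symm.permCongrHom).injective hab)
  have hψ : ∀ (τ : E ≃ₐ[ℚ] E) i, τ • e i = e (ψ (Gal.restrict f0 E τ) i) := by
    intro τ i
    apply RingOfIntegers.ext
    have h1 : e' (ψ (Gal.restrict f0 E τ) i) = Gal.galActionHom f0 E (Gal.restrict f0 E τ) (e' i) := by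
      change e' (e'.symm _) = _
      rw [Equiv.apply_symm_apply]
      rfl
    have h2 := congrArg Subtype.val h1
    rw [Gal.galActionHom_restrict] at h2
    exact h2.symm
  let G := ψ.range
  have hcard : Nat.card G = Nat.card f0.Gal :=
    (Nat.card_congr (MonoidHom.ofInjective hψi).toEquiv).symm
  have hsP : ψ (Gal.restrict f0 E σ) = sP := by
    ext i
    have := hei ((hψ σ i).symm.trans (hσ i))
    rw [this]
  have h11 : 11 ∣ Nat.card f0.Gal := by
    rw [← sP_order, ← hsP, orderOf_injective ψ hψi]
    exact orderOf_dvd_natCard _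
  have hd8 : 8 ∣ Nat.card f0.Gal := by
    have : orderOf (ψ (Gal.restrict f0 E σ5)) = 2 ^ (2 + 1) := by
      apply orderOf_eq_prime_pow
      · intro hc
        obtain ⟨i, rfl⟩ := hes r5 hr5
        apply h4
        have := hψ (σ5 ^ 4) i
        rw [map_pow, map_pow, show 4 = 2 ^ 2 from rfl, hc] at this
        exact this
      · ext i
        have := hψ (σ5 ^ 8) i
        rw [h8 _ (her i), map_pow, map_pow] at this
        exact congrArg Fin.val (hei this).symm
    rw [orderOf_injective ψ hψi] at this
    rw [show 8 = 2 ^ (2 + 1) from rfl, ← this]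
    exact orderOf_dvd_natCard _
  have hd12 : 12 ∣ Nat.card f0.Gal := by
    have h12 : f0.natDegree = 12 := by rw [f0_eq, hmf.2]; rfl
    have := deg_dvd_card f0 hirr (by rw [h12]; norm_num)
    rwa [h12] at this
  have hd : 264 ∣ Nat.card G := by
    rw [hcard]; omega
  have hAA : ∀ π ∈ G, Aut π := by
    rintro _ ⟨g, rfl⟩
    obtain ⟨τ, rfl⟩ := Gal.restrict_surjective f0 E g
    exact hA τ _ (hψ τ)
  obtain ⟨hc, hsimp⟩ := m11_main G hAA ⟨_, hsP⟩ hd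
  refine ⟨hirr, ?_, hcard ▸ hc⟩
  exact MulEquiv.isSimpleGroup (MonoidHom.ofInjective hψi)

theorem gal_main : Irreducible f0 ∧ IsSimpleGroup f0.Gal ∧ Nat.card f0.Gal = 7920 := by
  have : NumberField (f0 * pl ℚ (gL ++ [1])).SplittingField := {}
  have ha : (DivisionRing.toRatAlgebra : Algebra ℚ (f0 * pl ℚ (gL ++ [1])).SplittingField) =
    Polynomial.SplittingField.instAlgebra_1 _ := Subsingleton.elim _ _
  have hN : @Normal ℚ (f0 * pl ℚ (gL ++ [1])).SplittingField _ _ DivisionRing.toRatAlgebra := by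
    rw [ha]
    exact Normal.of_isSplittingField (f0 * pl ℚ (gL ++ [1]))
  have hs : ((f0 * pl ℚ (gL ++ [1])).map (@algebraMap ℚ (f0 * pl ℚ (gL ++ [1])).SplittingField _ _
      DivisionRing.toRatAlgebra)).Splits := by
    rw [ha]
    exact SplittingField.splits (f0 * pl ℚ (gL ++ [1]))
  have : IsGalois ℚ (f0 * pl ℚ (gL ++ [1])).SplittingField := ⟨⟩
  exact gal_aux hs

end M11

namespace M11
open NumberField Polynomial Module

theorem ev_sum {R : Type*} [CommRing R] (x : R) : ∀ (n : ℕ) (l : List ℤ), l.length ≤ n →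
    ev x l = ∑ i : Fin n, ((l.getD i 0 : ℤ) : R) * x ^ (i : ℕ)
  | 0, l, h => by
    have : l = [] := List.length_eq_zero_iff.1 (by omega)
    simp [this]
  | n + 1, [], h => by simp
  | n + 1, a :: l, h => by
    rw [ev_cons, ev_sum x n l (by simpa using h), Fin.sum_univ_succ, Finset.mul_sum]
    simp [pow_succ]
    exact Finset.sum_congr rfl fun i _ => by ring

section
variable {K : Type} [Field K] [NumberField K]

theorem repr_ev (b : Basis (Fin 12) ℚ K) (t : K) (hb : ∀ i, b i = t ^ (i : ℕ)) (l : List ℤ)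
    (hl : l.length ≤ 12) (i : Fin 12) : b.repr (ev t l) i = ((l.getD i 0 : ℤ) : ℚ) := by
  have : ev t l = ∑ i : Fin 12, ((l.getD i 0 : ℤ) : ℚ) • b i := by
    rw [ev_sum t 12 l hl]
    refine Finset.sum_congr rfl fun i _ => ?_
    rw [hb, Algebra.smul_def]; simp
  rw [this]
  simp only [map_sum, map_smul, Basis.repr_self, Finsupp.coe_finsetSum, Finset.sum_apply,
    Finsupp.smul_apply, Finsupp.single_apply, smul_eq_mul, mul_ite, mul_one, mul_zero]
  simp

/-- LU certificate check -/
def luc (fl d : List ℤ) (V : List (List ℤ)) (n : ℤ) : Bool :=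
  decide ((∀ j : Fin 12, (V.getD j []).length ≤ 12 ∧ (mm 0 fl d (V.getD j [])).length ≤ 12) ∧
  (∀ i j : Fin 12, j < i → (V.getD j []).getD i 0 = 0) ∧
  (∀ i j : Fin 12, i < j → (mm 0 fl d (V.getD j [])).getD i 0 = 0) ∧
  (∏ j : Fin 12, (V.getD j []).getD j 0 ≠ 0) ∧
  (n * ∏ j : Fin 12, (V.getD j []).getD j 0 = ∏ j : Fin 12, (mm 0 fl d (V.getD j [])).getD j 0))

theorem norm_luc (b : Basis (Fin 12) ℚ K) (t : K) (hb : ∀ i, b i = t ^ (i : ℕ)) (fl d : List ℤ)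
    (h : ev t fl + t ^ fl.length = 0) (V : List (List ℤ)) (n : ℤ) (hc : luc fl d V n = true) :
    Algebra.norm ℚ (ev t d) = n := by
  obtain ⟨h1, h2, h3, h4, h5⟩ := of_decide_eq_true hc
  rw [Algebra.norm_eq_matrix_det b]
  set M := Algebra.leftMulMatrix b (ev t d)
  let A : Matrix (Fin 12) (Fin 12) ℚ := fun i j => (((V.getD j []).getD i 0 : ℤ) : ℚ)
  let B : Matrix (Fin 12) (Fin 12) ℚ := fun i j => (((mm 0 fl d (V.getD j [])).getD i 0 : ℤ) : ℚ)
  have hM : M * A = B := by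
    ext i j
    have e1 : (M * A) i j = (M.mulVec (b.repr (ev t (V.getD j [])))) i := by
      simp only [Matrix.mul_apply, Matrix.mulVec, dotProduct]
      refine Finset.sum_congr rfl fun k _ => ?_
      rw [repr_ev b t hb _ (h1 j).1]
    rw [e1, Algebra.leftMulMatrix_mulVec_repr, ← ev_mm (p := 0) (by simp) t fl h,
      repr_ev b t hb _ (h1 j).2]
  have hA : A.det = ((∏ j : Fin 12, (V.getD j []).getD j 0 : ℤ) : ℚ) := by
    rw [Matrix.det_of_upperTriangular]
    · simp [A]
    · intro i j hij
      simp only [A]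
      rw [h2 i j hij]; rfl
  have hB : B.det = ((∏ j : Fin 12, (mm 0 fl d (V.getD j [])).getD j 0 : ℤ) : ℚ) := by
    rw [Matrix.det_of_lowerTriangular]
    · simp [B]
    · intro i j hij
      simp only [B]
      rw [h3 i j (by simpa using hij)]; rfl
  have hd := congrArg Matrix.det hM
  rw [Matrix.det_mul, hA, hB, ← h5] at hd
  push_cast at hd
  refine mul_right_cancel₀ ?_ hd
  exact_mod_cast h4

theorem pbasis (t : K) (fl : List ℤ) (hl : fl.length = 12) (hK : finrank ℚ K = 12)
    (hm : minpoly ℚ t = pl ℚ (fl ++ [1])) (d : List ℤ)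
    (hd : derivative (pl ℚ (fl ++ [1])) = pl ℚ d) (V : List (List ℤ)) (n : ℤ)
    (hc : luc fl d V n = true) :
    Algebra.discr ℚ (fun i : Fin 12 => t ^ (i : ℕ)) = n := by
  have hne : fl ≠ [] := by rintro rfl; simp at hl
  have hli := linearIndependent_pow (K := ℚ) t
  have hdeg : (minpoly ℚ t).natDegree = 12 := by rw [hm, (pl_monic fl hne).2, hl]
  rw [hdeg] at hli
  let b := basisOfLinearIndependentOfCardEqFinrank hli (by simp [hK])
  have hb : ∀ i, b i = t ^ (i : ℕ) := fun i => by simp [b]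
  let pb : PowerBasis ℚ K := ⟨t, 12, b, hb⟩
  have hz : ev t fl + t ^ fl.length = 0 := by
    have := minpoly.aeval ℚ t
    rwa [hm, pl_aeval, ev1] at this
  have h1 := Algebra.discr_powerBasis_eq_norm ℚ pb
  have h2 : (pb.basis : Fin pb.dim → K) = fun i : Fin 12 => t ^ (i : ℕ) := by
    funext i; exact hb i
  have h3 : Algebra.discr ℚ (fun i : Fin 12 => t ^ (i : ℕ)) = Algebra.discr ℚ pb.basis := by
    rw [h2]
  rw [h3, h1]
  have h4 : aeval pb.gen (minpoly ℚ pb.gen).derivative = ev t d := by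
    change aeval t (minpoly ℚ t).derivative = _
    rw [hm, hd, pl_aeval]
  rw [h4, norm_luc b t hb fl d hz V n hc, hK]
  norm_num
end
end M11

namespace M11
open NumberField Polynomial Module

section
variable {K : Type} [Field K] [NumberField K]

def Ded (t : 𝓞 K) (p : ℕ) : Prop :=
  ∀ c : Fin 12 → ℤ, (∃ y : 𝓞 K, ∑ i, (c i : 𝓞 K) * t ^ (i : ℕ) = (p : 𝓞 K) * y) →
    ∀ i, (p : ℤ) ∣ c i

open nonZeroDivisors in
theorem index_lem (t : 𝓞 K) (hK : finrank ℚ K = 12) (n : ℤ)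
    (hD : Algebra.discr ℚ (fun i : Fin 12 => (t : K) ^ (i : ℕ)) = n) :
    ∃ a : ℤ, discr K * a ^ 2 = n ∧ ∀ p : ℕ, p.Prime → Ded t p → ¬ (p : ℤ) ∣ a := by
  let B : Basis (Fin 12) ℤ (𝓞 K) :=
    Module.finBasisOfFinrankEq ℤ (𝓞 K) (by rw [RingOfIntegers.rank, hK])
  let P : Matrix (Fin 12) (Fin 12) ℤ := fun j i => B.repr (t ^ (i : ℕ)) j
  have hP : ∀ i : Fin 12, t ^ (i : ℕ) = ∑ j, (P j i : 𝓞 K) * B j := by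
    intro i
    conv_lhs => rw [← B.sum_repr (t ^ (i : ℕ))]
    refine Finset.sum_congr rfl fun j _ => by simp [P]
  refine ⟨P.det, ?_, ?_⟩
  · let b' := B.localizationLocalization ℚ ℤ⁰ K
    have h1 : Algebra.discr ℚ b' = ((discr K : ℤ) : ℚ) := by
      rw [Algebra.discr_localizationLocalization, discr_eq_discr]; rfl
    have h2 : (fun i : Fin 12 => (t : K) ^ (i : ℕ)) =
        Matrix.vecMul b' ((P.map (Int.cast : ℤ → ℚ)).map (algebraMap ℚ K)) := by
      funext i
      have := congrArg (algebraMap (𝓞 K) K) (hP i)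
      rw [map_pow, map_sum] at this
      rw [this]
      simp only [Matrix.vecMul, dotProduct]
      refine Finset.sum_congr rfl fun j _ => ?_
      simp [b', Basis.localizationLocalization_apply, mul_comm]
    rw [h2, Algebra.discr_of_matrix_vecMul, h1] at hD
    have h3 : (P.map (Int.cast : ℤ → ℚ)).det = ((P.det : ℤ) : ℚ) := by
      have := RingHom.map_det (Int.castRingHom ℚ) P
      simpa [RingHom.mapMatrix_apply] using this.symm
    rw [h3] at hD
    have : P.det ^ 2 * discr K = n := by exact_mod_cast hD
    rw [← this, mul_comm]
  · intro p hp hded hdvd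
    haveI : Fact p.Prime := ⟨hp⟩
    have h0 : (P.map (Int.cast : ℤ → ZMod p)).det = 0 := by
      have := RingHom.map_det (Int.castRingHom (ZMod p)) P
      rw [RingHom.mapMatrix_apply] at this
      rw [← (ZMod.intCast_zmod_eq_zero_iff_dvd P.det p).2 hdvd]
      simpa using this.symm
    obtain ⟨v, hv, hv0⟩ := Matrix.exists_mulVec_eq_zero_iff.2 h0
    let c : Fin 12 → ℤ := fun i => ((v i).val : ℤ)
    have hc : ∀ i, ((c i : ℤ) : ZMod p) = v i := fun i => by simp [c]
    have hd : ∀ j, (p : ℤ) ∣ ∑ i, P j i * c i := by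
      intro j
      rw [← ZMod.intCast_zmod_eq_zero_iff_dvd]
      have := congrFun hv0 j
      simp only [Matrix.mulVec, dotProduct, Matrix.map_apply, Pi.zero_apply] at this
      push_cast
      simp only [hc]
      exact this
    choose y hy using hd
    apply hv
    funext i
    rw [← hc, Pi.zero_apply, ZMod.intCast_zmod_eq_zero_iff_dvd]
    refine hded c ⟨∑ j, (y j : 𝓞 K) * B j, ?_⟩ i
    simp only [hP]
    simp only [Finset.mul_sum]
    rw [Finset.sum_comm]
    refine Finset.sum_congr rfl fun j _ => ?_
    have := congrArg (Int.cast : ℤ → 𝓞 K) (hy j)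
    push_cast at this
    rw [← mul_assoc, ← this, Finset.sum_mul]
    exact Finset.sum_congr rfl fun i _ => by ring
end
end M11

namespace M11
open NumberField Polynomial Module

section
variable {K : Type} [Field K] [NumberField K]

theorem ded (t : 𝓞 K) (p : ℕ) (hp : p.Prime) (F g h T : ℤ[X]) (hFm : F.Monic)
    (hFd : F.natDegree = 12) (hFt : minpoly ℤ t = F) (hgh : F = g * h + (p : ℤ[X]) * T)
    (hsq : Squarefree (g.map (Int.castRingHom (ZMod p)))) (N : ℕ)
    (hN : F.map (Int.castRingHom (ZMod p)) ∣ (g.map (Int.castRingHom (ZMod p))) ^ N)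
    (hcop : IsCoprime (h.map (Int.castRingHom (ZMod p))) (T.map (Int.castRingHom (ZMod p)))) :
    Ded t p := by
  have : Fact p.Prime := ⟨hp⟩
  let φ : ℤ[X] →+* 𝓞 K := (aeval (R := ℤ) t).toRingHom
  let r : ℤ[X] →+* (ZMod p)[X] := mapRingHom (Int.castRingHom (ZMod p))
  have hr : Function.Surjective r := map_surjective _ (ZMod.intCast_surjective)
  have hrp : r (p : ℤ[X]) = 0 := by
    rw [map_natCast, ← map_natCast (C : ZMod p →+* (ZMod p)[X])]; simp
  have hker : ∀ q, r q = 0 → ∃ s, q = (p : ℤ[X]) * s := by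
    intro q hq
    have : C (p : ℤ) ∣ q := by
      rw [C_dvd_iff_dvd_coeff]
      intro i
      have := congrArg (fun f => coeff f i) hq
      simp only [r, coe_mapRingHom, coeff_map, coeff_zero, eq_intCast] at this
      exact (ZMod.intCast_zmod_eq_zero_iff_dvd _ _).1 this
    obtain ⟨s, hs⟩ := this
    exact ⟨s, by rw [hs]; simp⟩
  let J : Ideal ℤ[X] := (Ideal.span {(p : 𝓞 K)}).comap φ
  have hJ : ∀ q, q ∈ J ↔ (p : 𝓞 K) ∣ φ q := fun q => by
    simp only [J, Ideal.mem_comap, Ideal.mem_span_singleton]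
  let I : Ideal (ZMod p)[X] := J.map r
  have hIJ : ∀ q, r q ∈ I → q ∈ J := by
    intro q hq
    obtain ⟨j, hj, hjq⟩ := (Ideal.mem_map_iff_of_surjective r hr).1 hq
    obtain ⟨s, hs⟩ := hker (q - j) (by rw [map_sub, hjq, sub_self])
    have : q = j + (p : ℤ[X]) * s := by rw [← hs]; ring
    rw [hJ] at hj ⊢
    rw [this, map_add, map_mul, map_natCast]
    exact dvd_add hj (dvd_mul_right _ _)
  have hF0 : φ F = 0 := by
    rw [← hFt]; exact minpoly.aeval ℤ t
  obtain ⟨D, hD⟩ := IsPrincipalIdealRing.principal I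
  have hDI : ∀ q, q ∈ I ↔ D ∣ q := fun q => by rw [hD]; exact Ideal.mem_span_singleton
  have hFI : r F ∈ I := Ideal.mem_map_of_mem r ((hJ F).2 (by rw [hF0]; exact dvd_zero _))
  have hrFm : (r F).Monic := hFm.map _
  have hrFd : (r F).natDegree = 12 := by
    rw [← hFd]; exact hFm.natDegree_map _
  obtain ⟨c₀, hc₀⟩ := (hDI _).1 hFI
  by_cases hu : IsUnit c₀
  · intro c ⟨y, hy⟩ i
    let G : ℤ[X] := ∑ i : Fin 12, C (c i) * X ^ (i : ℕ)
    have hG : G ∈ J := by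
      rw [hJ]
      refine ⟨y, ?_⟩
      rw [← hy]
      simp [G, φ, map_sum]
    have hGI := (hDI _).1 (Ideal.mem_map_of_mem r hG)
    have hFG : r F ∣ r G := by
      rw [hc₀]
      exact (IsUnit.mul_right_dvd hu).2 hGI
    have hdeg : (r G).degree < (r F).degree := by
      rw [degree_eq_natDegree hrFm.ne_zero, hrFd]
      refine lt_of_le_of_lt (degree_map_le) ?_
      rw [degree_lt_iff_coeff_zero]
      intro m hm
      simp only [G, finsetSum_coeff, coeff_C_mul, coeff_X_pow]
      refine Finset.sum_eq_zero fun i _ => ?_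
      rw [if_neg (by have := i.2; omega), mul_zero]
    have hG0 : r G = 0 := eq_zero_of_dvd_of_degree_lt hFG hdeg
    have := congrArg (fun f => coeff f (i : ℕ)) hG0
    simp only [r, coe_mapRingHom, coeff_map, coeff_zero, eq_intCast] at this
    rw [ZMod.intCast_zmod_eq_zero_iff_dvd] at this
    convert this
    simp only [G, finsetSum_coeff, coeff_C_mul, coeff_X_pow]
    rw [Finset.sum_eq_single i]
    · simp
    · intro j _ hj
      rw [if_neg (fun h => hj (Fin.ext h.symm)), mul_zero]
    · simp
  · exfalso
    have hc0 : c₀ ≠ 0 := by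
      rintro rfl
      rw [mul_zero] at hc₀
      exact hrFm.ne_zero hc₀
    obtain ⟨π, hπ, C', hC'⟩ := WfDvdMonoid.exists_irreducible_factor hu hc0
    have hπF : π ∣ r F := by rw [hc₀, hC']; exact ⟨D * C', by ring⟩
    have hπp : Prime π := hπ.prime
    obtain ⟨g₁, hg₁⟩ : π ∣ r g := hπp.dvd_of_dvd_pow (hπF.trans hN)
    have hrF : r F = r g * r h := by
      rw [hgh, map_add, map_mul, map_mul, hrp]; ring
    have hgI : g₁ * r h ∈ I := by
      rw [hDI]
      refine ⟨C', mul_left_cancel₀ hπ.ne_zero ?_⟩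
      have : r F = D * (π * C') := by rw [hc₀, hC']
      rw [hrF, hg₁] at this
      linear_combination this
    obtain ⟨ϖ, hϖ⟩ := hr π
    obtain ⟨γ, hγ⟩ := hr g₁
    obtain ⟨s, hs⟩ := hker (g - ϖ * γ) (by rw [map_sub, map_mul, hϖ, hγ, hg₁, sub_self])
    have hγJ : γ * h ∈ J := hIJ _ (by rw [map_mul, hγ]; exact hgI)
    obtain ⟨x, hx⟩ := (hJ _).1 hγJ
    have hp0 : (p : 𝓞 K) ≠ 0 := by exact_mod_cast hp.ne_zero
    have hkey : φ ϖ * x + φ (s * h + T) = 0 := by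
      apply mul_left_cancel₀ hp0
      rw [mul_zero, ← hF0]
      have : F = ϖ * (γ * h) + (p : ℤ[X]) * (s * h + T) := by
        rw [hgh]; linear_combination h * hs
      rw [this, map_add φ (ϖ * _), map_mul φ ϖ, hx, map_mul φ (p : ℤ[X]), map_natCast]
      ring
    -- the maximal ideal
    let _ : Algebra ℤ[X] (𝓞 K) := φ.toAlgebra
    have : IsScalarTower ℤ ℤ[X] (𝓞 K) := IsScalarTower.of_algebraMap_eq fun n => by
      change _ = φ _
      simp [φ]
    have hint : Algebra.IsIntegral ℤ[X] (𝓞 K) := Algebra.IsIntegral.tower_top (R := ℤ)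
    have hmax : (Ideal.span {π}).IsMaximal :=
      PrincipalIdealRing.isMaximal_of_irreducible hπ
    have hmax' : ((Ideal.span {π}).comap r).IsMaximal :=
      Ideal.comap_isMaximal_of_surjective r hr
    obtain ⟨Q, hQ, hQc⟩ := Ideal.exists_ideal_over_maximal_of_isIntegral (S := 𝓞 K)
      ((Ideal.span {π}).comap r) (by
        intro q hq
        have hq' : aeval t q = 0 := hq
        have : F ∣ q := by
          rw [← hFt]
          exact minpoly.isIntegrallyClosed_dvd (Algebra.IsIntegral.isIntegral t) hq'
        rw [Ideal.mem_comap, Ideal.mem_span_singleton]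
        exact hπF.trans (map_dvd r this))
    have hQm : ∀ q, φ q ∈ Q ↔ π ∣ r q := by
      intro q
      rw [← Ideal.mem_span_singleton]
      change q ∈ Q.comap (algebraMap ℤ[X] (𝓞 K)) ↔ q ∈ (Ideal.span {π}).comap r
      rw [hQc]
    have hQp := hQ.isPrime
    have h1 : φ (s * h + T) ∈ Q := by
      have : φ (s * h + T) = - (φ ϖ * x) := by linear_combination hkey
      rw [this]
      exact Q.neg_mem (Q.mul_mem_right _ ((hQm _).2 (by rw [hϖ])))
    rw [hQm, map_add, map_mul] at h1
    by_cases hh : π ∣ r h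
    · have hT : π ∣ r T := (dvd_add_right (hh.mul_left _)).1 h1
      exact hπ.not_isUnit (hcop.isUnit_of_dvd' hh hT)
    · have h2 : φ γ * φ h ∈ Q := by
        rw [← map_mul, hx]
        refine Q.mul_mem_right _ ?_
        rw [← map_natCast φ, hQm, hrp]
        exact dvd_zero _
      rcases hQp.mem_or_mem h2 with h3 | h3
      · rw [hQm, hγ] at h3
        obtain ⟨g₂, hg₂⟩ := h3
        exact hπ.not_isUnit (hsq π ⟨g₂, by
          change r g = _
          rw [hg₁, hg₂]; ring⟩)
      · exact hh ((hQm _).1 h3)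
end
end M11

namespace M11
open NumberField Polynomial Module

def mulL : List ℤ → List ℤ → List ℤ
  | [], _ => []
  | a :: l, b => addL (smulL a b) (0 :: mulL l b)

def derL : List ℤ → List ℤ
  | [] => []
  | _ :: l => addL l (0 :: derL l)

def hmL (n : ℤ) : List ℤ → List ℤ
  | [] => []
  | a :: l => (a * n ^ l.length) :: hmL n l

def pwL (l : List ℤ) : ℕ → List ℤ
  | 0 => [1]
  | n + 1 => mulL l (pwL l n)

section
variable {R : Type*} [CommRing R]

theorem ev_mulL (x : R) : ∀ a b : List ℤ, ev x (mulL a b) = ev x a * ev x b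
  | [], b => by simp [mulL]
  | a :: l, b => by
    rw [mulL, ev_add, ev_smul, ev_cons, ev_mulL x l b, ev_cons]; push_cast; ring

theorem ev_pwL (x : R) (l : List ℤ) : ∀ n, ev x (pwL l n) = ev x l ^ n
  | 0 => by simp [pwL]
  | n + 1 => by rw [pwL, ev_mulL, ev_pwL x l n, pow_succ']

theorem pl_der : ∀ l : List ℤ, derivative (pl R l) = pl R (derL l)
  | [] => by simp [pl, derL]
  | a :: l => by
    have := pl_der l
    simp only [pl, derL, ev_cons, ev_add, derivative_add, derivative_mul, derivative_X] at *
    rw [this]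
    simp

theorem ev_hm (n : ℤ) (y : R) : ∀ l : List ℤ,
    ev ((n : R) * y) (hmL n l) * n = (n : R) ^ l.length * ev y l
  | [] => by simp [hmL]
  | a :: l => by
    have := ev_hm n y l
    rw [hmL, ev_cons, ev_cons, List.length_cons, pow_succ]
    push_cast
    linear_combination (n : R) * y * this

theorem ev_eq {p : ℤ} (hp : (p : R) = 0) (x : R) (a b : List ℤ) (h : zc p (subL a b) = true) :
    ev x a = ev x b := by
  have := ev_zc hp x _ h
  rw [ev_sub] at this
  exact sub_eq_zero.1 this
end

section
variable {K : Type} [Field K] [NumberField K]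

theorem dedL (t : 𝓞 K) (p : ℕ) (hp : p.Prime) (fl g h T a b c e co : List ℤ) (N : ℕ)
    (hl : fl.length = 12) (hm : minpoly ℚ (t : K) = pl ℚ (fl ++ [1]))
    (h1 : zc 0 (subL (fl ++ [1]) (addL (mulL g h) (smulL p T))) = true)
    (h2 : zc p (subL (addL (mulL a g) (mulL b (derL g))) [1]) = true)
    (h3 : zc p (subL (pwL g N) (mulL (fl ++ [1]) co)) = true)
    (h4 : zc p (subL (addL (mulL c h) (mulL e T)) [1]) = true) : Ded t p := by
  have hne : fl ≠ [] := by rintro rfl; simp at hl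
  have hmm : minpoly ℤ t = pl ℤ (fl ++ [1]) := by
    have := minpoly.isIntegrallyClosed_eq_field_fractions ℚ K (Algebra.IsIntegral.isIntegral (R := ℤ) t)
    rw [hm, ← pl_map (algebraMap ℤ ℚ)] at this
    exact (map_injective _ (FaithfulSMul.algebraMap_injective ℤ ℚ) this).symm
  have hpz : (((p : ℤ)) : (ZMod p)[X]) = 0 := by
    rw [Int.cast_natCast, ← map_natCast (C : ZMod p →+* (ZMod p)[X])]; simp
  have : Fact p.Prime := ⟨hp⟩
  refine ded t p hp (pl ℤ (fl ++ [1])) (pl ℤ g) (pl ℤ h) (pl ℤ T) (pl_monic fl hne).1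
    (by rw [(pl_monic fl hne).2, hl]) hmm ?_ ?_ N ?_ ?_
  · have := ev_eq (p := 0) (by simp) (X : ℤ[X]) _ _ h1
    rw [ev_add, ev_mulL, ev_smul] at this
    simpa [pl] using this
  · rw [pl_map]
    apply Separable.squarefree
    refine ⟨pl _ a, pl _ b, ?_⟩
    rw [pl_der]
    have := ev_eq hpz X _ _ h2
    rw [ev_add, ev_mulL, ev_mulL] at this
    simpa [pl] using this
  · rw [pl_map, pl_map]
    refine ⟨pl _ co, ?_⟩
    have := ev_eq hpz X _ _ h3
    rw [ev_mulL, ev_pwL] at this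
    simpa [pl] using this
  · rw [pl_map, pl_map]
    refine ⟨pl _ c, pl _ e, ?_⟩
    have := ev_eq hpz X _ _ h4
    rw [ev_add, ev_mulL, ev_mulL] at this
    simpa [pl] using this
end

theorem arith (d a b q : ℤ) (hq2 : ¬ (2:ℤ) ∣ q) (hq3 : ¬ (3:ℤ) ∣ q)
    (h1 : d * a ^ 2 = 2 ^ 132 * 3 ^ 36 * 6451 ^ 4) (ha : ¬ (6451:ℤ) ∣ a)
    (h2 : d * b ^ 2 = 2 ^ 22 * 6451 ^ 4 * q ^ 2) (hb : ¬ (2:ℤ) ∣ b) :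
    d = 2 ^ 22 * 6451 ^ 4 := by
  have p2 : Prime (2:ℤ) := Int.prime_two
  have p3 : Prime (3:ℤ) := Int.prime_three
  have p6 : Prime (6451:ℤ) := by
    rw [Int.prime_iff_natAbs_prime]; norm_num
  have cop : ∀ {p x : ℤ} (m n : ℕ), Prime p → ¬ p ∣ x → IsCoprime (p ^ m) (x ^ n) :=
    fun m n hp hx => ((Prime.coprime_iff_not_dvd hp).2 hx).pow
  obtain ⟨e, rfl⟩ : (6451:ℤ) ^ 4 ∣ d :=
    (cop 4 2 p6 ha).dvd_of_dvd_mul_right (by rw [h1]; exact dvd_mul_left _ _)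
  have h1' : e * a ^ 2 = 2 ^ 132 * 3 ^ 36 := by
    apply mul_left_cancel₀ (show (6451:ℤ) ^ 4 ≠ 0 by norm_num)
    linear_combination h1
  have h2' : e * b ^ 2 = 2 ^ 22 * q ^ 2 := by
    apply mul_left_cancel₀ (show (6451:ℤ) ^ 4 ≠ 0 by norm_num)
    linear_combination h2
  obtain ⟨e', rfl⟩ : (2:ℤ) ^ 22 ∣ e :=
    (cop 22 2 p2 hb).dvd_of_dvd_mul_right (by rw [h2']; exact dvd_mul_right _ _)
  have h3 : e' * b ^ 2 = q ^ 2 := by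
    apply mul_left_cancel₀ (show (2:ℤ) ^ 22 ≠ 0 by norm_num)
    linear_combination h2'
  have k2 : ¬ (2:ℤ) ∣ e' := fun h => hq2 (p2.dvd_of_dvd_pow (h3 ▸ h.mul_right _))
  have k3 : ¬ (3:ℤ) ∣ e' := fun h => hq3 (p3.dvd_of_dvd_pow (h3 ▸ h.mul_right _))
  have h4 : e' ∣ 2 ^ 132 * 3 ^ 36 := ⟨2 ^ 22 * a ^ 2, by rw [← h1']; ring⟩
  have c2 := (cop 132 1 p2 k2)
  have c3 := (cop 36 1 p3 k3)
  rw [pow_one] at c2 c3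
  have hu : IsUnit e' := by
    have := c2.symm.dvd_of_dvd_mul_left h4
    exact c3.symm.isUnit_of_dvd' dvd_rfl this
  rcases Int.isUnit_iff.1 hu with rfl | rfl
  · ring
  · nlinarith [sq_nonneg b, sq_nonneg q, show q ≠ 0 by rintro rfl; simp at hq2, sq_pos_of_ne_zero (show q ≠ 0 by rintro rfl; simp at hq2)]
end M11

namespace M11
open NumberField Polynomial Module IntermediateField

def kL : List ℤ := [82, -31256, -74172, 65162, 98617, 13512, -3582, 2844, 442, 20, 54, -2]
def uL : List ℤ := [607552, 2895392, 2568224, -854320, 76608, -1304336, -555648, -344872, -116484, -26974, -3154, -131]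
def wL : List ℤ := [32779936403904380743332399940, 46500719330714488845861300370, -314698898172538927557900291413, -254573173013481516547202664890, -16154790292255184068011298308, 1745704470529574692180894629, -7351762735342130001506851955, -777161759287910720570883171, -195496712864726500691682486, -101406455152173888193726985, 1411179711345403727560460, -2022711837839275014202073]
def v1 : List (List ℤ) := [[1],
  [14, 13],
  [168, 878, 361],
  [-48524, 129036, 316626, 32797],
  [9270716, -65960088, 685797252, 963358952, 82471659],
  [6827974496, 68225623972, 178138110712, 242665392412, 365486586704, 32635140925],
  [-16080292327624, -148945180043408, -455179819427388, 162434982834552, 167126349704154, 152219029138880, 13356776187035],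
  [860656969743536, 7923231897421384, 24071206538854488, -10557597598272996, 1543701207757164, 6359630094379454, 2866244143457606, 222372003869817],
  [53611960569592880, 673170326890633024, 3158466138262035056, 4398633390820210672, -1897988432553819984, -459039288628008784, -122602490448105484, 210048077510888564, 21447242803841753],
  [-1476888243901280, -16206322551171120, -65262618076636512, -53728960196145168, 29863464303049424, 14370840601831312, 19595051006562872, 1627149171287732, 256088342846978, 26545259797351],
  [-22584182950112, -252942070113792, -1044042602153584, -953778782077088, 562107207488368, 226299054014864, 356917322812952, 162942214015336, 41618344844626, 4956347609532, 206816878673],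
  [72424576, 773411104, 2925949760, 1318787856, -3382463968, 202444464, -767103248, 67839288, 124157552, 49647586, 7135760, 323633]]
def v2 : List (List ℤ) := [[1],
  [-123, 3907],
  [129929, -60857737, 340383856],
  [-2912646342700, 1116410119114801, 221931547591322, 122409317181814],
  [-2743265544837436350, 1046720123926342256000, 2067553199917485614872, -517651830137578351216, 184802887463473588783],
  [5600904430022509006748554, -2139303964713056174374924666, -3369469393069300168417863268, 1382061631825109565534765952, -336912186639061180543062765, 15487929665054068039152469],
  [40820872724372535106947674219996, -15562342568304337681812458858977814, -35911101107050441094475631183158212, 29528430323732009778264029046891968, 19011278469483231544339418285129970, 103630091076093062639650651403771, 757580233794336639158623964405670],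
  [2991583418717711556670588441465687682, -1079338698745979409077349078162357584846, -25946197692583471286750138279992652988558, -51986716046378664011122727985242141207764, 46230651133405310309814521288342684685935, 29150146650353807409170653409746748593083, 210492827462025807926733670156694696905, 1158292591457130400513270669938120525479],
  [1946123635386854924562876872743956753640851450, -744284564241434024483862437761386985475019355714, -813840593809653134143300255397623834172675909558, 3214755930085063789333788841153568998612692269616, -493409494593905628519341134364081288870091802597, -590947215549102062575781037256858888991328883195, 76205657021962703690223869784172817263681268109, -28292382074068422628546119372433787212512069035, 1838236876343003212141917489266815597980110642],
  [4222249450801801274798087468881201926730569519026, -1611382201707713540296197795825900501282498322828222, -3062341178772318173924293187451805115313382747413876, 4964943298354517926560907385295084355826944641361500, 3176325612994687363181903418806983800122189694424485, -1019778632940420021593804756245832660073461998236305, -147078796413052910685242598368061154652706709268244, 73769027249508337638664139596682674029280428966635, -16640173855535373366252639169667962143205196830045, 3138784554046080217230690104714165136252338567059],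
  [12805739015021372764077064526846611749750613766785498, -4888100378495783244020748999330694520002037462989808150, -8938245035460626852032185477052364693661584634994301748, 14736793138379602592625344157450792747078107354365192548, 7043915103228516943281859010079869415192553152254331897, -564086873945738528593562455160964793727134110420441469, -28008579985365475649828934557124476388576223214235132, 19059249979552839466770573485399027396138911446998299, 35891689673479081897984899631171064310699497927740855, -2502825295191981565506630692009330817292239883573909, 1698643898829356088439822302248291169606820419952404],
  [57392299391995859709200136753061905703331245944018828314, -21910503128750165788059260388306422321937126025557768231550, -38841725624772726377396949744818459142890339893890840337884, 68543649020184734048686833798234625645871708640836478966564, 27649055952009763471303128224810777874955761251902937671761, -6279573692447555606140075797961810351942589244151893870257, 1964345438110176639047388883989188548553192680085659985904, 414661961706705967861347149468037399106402265437385955107, -1663326951089589551101192749003842031394799387380705465, 46408439961645909137785835088635164179656962875840868663, -1030782525953972180069574536955320165700659493563859108, 886087554804841008766499425009096068872301708058487820]]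

section
variable {K : Type} [Field K] [NumberField K]

theorem ded2 (t : 𝓞 K) (hm : minpoly ℚ (t : K) = pl ℚ (kL ++ [1])) : Ded t 2 :=
  dedL t 2 (by norm_num) kL [0, 1, 1] [0, 0, 0, 1, 7, 21, 35, 35, 21, 7, 1]
    [41, -15628, -37086, 32581, 49308, 6752, -1805, 1394, 186, -18, 13, -5]
    [] [1]
    [0, 1, 0, 1, 0, 0, 0, 1, 0, 1, 1] [1, 0, 0, 1, 1, 1, 0, 1, 1, 1]
    [0, 0, 0, 0, 1] 8 rfl hm
    (by decide +kernel) (by decide +kernel) (by decide +kernel) (by decide +kernel)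

theorem ded6 (t : 𝓞 K) (hm : minpoly ℚ (t : K) = pl ℚ (fL ++ [1])) : Ded t 6451 :=
  dedL t 6451 (by norm_num) fL [4085, 711, 1717, 4218, 201, 2514, 3642, 3352, 1] [2405, 4163, 4690, 3123, 1]
    [-1523, -2902, -4072, -5178, -4389, -4965, -5167, -5525, -6028, -4201, -1624, -1]
    [3640, 2765, 2887, 3529, 338, 2672, 5236] [6424, 293, 3541, 3147, 2389, 2192, 6049, 2571]
    [3140, 741, 2068, 6313, 1162, 4790, 783, 1759, 1858, 2517, 2782] [4124, 188, 5389, 2782]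
    [5648, 5226, 6297, 229, 1] 2 rfl hm
    (by decide +kernel) (by decide +kernel) (by decide +kernel) (by decide +kernel)

theorem isInt (t : K) (fl : List ℤ) (hl : fl ≠ []) (hm : minpoly ℚ t = pl ℚ (fl ++ [1])) :
    IsIntegral ℤ t := by
  refine ⟨pl ℤ (fl ++ [1]), (pl_monic fl hl).1, ?_⟩
  have h1 := pl_aeval (R := ℤ) t (fl ++ [1])
  have h2 := minpoly.aeval ℚ t
  rw [hm, pl_aeval] at h2
  rw [aeval_def] at h1
  rw [h1, h2]

theorem disc_main (hK : finrank ℚ K = 12) (t : K) (hm : minpoly ℚ t = pl ℚ (fL ++ [1])) :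
    discr K = 2 ^ 22 * 6451 ^ 4 := by
  have hz : ev t fL + t ^ fL.length = 0 := by
    have := minpoly.aeval ℚ t
    rwa [hm, pl_aeval, ev1] at this
  let s : K := ev t uL / 82944
  have hs : ev t uL = ((82944 : ℤ) : K) * s := by simp only [s]; push_cast; field_simp
  have hN : ((82944 : ℤ) : K) ≠ 0 := by norm_num
  have hs0 : ev s (kL ++ [1]) = 0 := by
    have h1 := ev_cmp (p := 0) (by simp) t fL hz uL (hmL 82944 (kL ++ [1]))
    have h2 : zc 0 (cmp 0 fL uL (hmL 82944 (kL ++ [1]))) = true := by decide +kernel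
    rw [ev_zc (by simp) t _ h2, hs] at h1
    have h3 := ev_hm 82944 s (kL ++ [1])
    rw [← h1, zero_mul] at h3
    exact (mul_eq_zero.1 h3.symm).resolve_left (pow_ne_zero _ hN)
  have ht : ev s wL = (27707478540903552051946732921 : ℤ) * t := by
    have h1 := ev_cmp (p := 0) (by simp) t fL hz uL (hmL 82944 wL)
    have h2 : zc 0 (subL (cmp 0 fL uL (hmL 82944 wL)) [0, 27707478540903552051946732921 * 82944 ^ 11]) = true := by
      decide +kernel
    rw [ev_eq (by simp) t _ _ h2, hs] at h1
    have h3 := ev_hm 82944 s wL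
    rw [← h1] at h3
    have h4 : wL.length = 12 := rfl
    rw [h4] at h3
    refine mul_left_cancel₀ (pow_ne_zero 12 hN) ?_
    rw [← h3]
    simp only [ev_cons, ev_nil]
    push_cast
    ring
  have htop : ℚ⟮s⟯ = ⊤ := by
    have h1 : ℚ⟮t⟯ = ⊤ := by
      rw [Field.primitive_element_iff_minpoly_natDegree_eq, hm, hK,
        (pl_monic fL (by simp [fL])).2]
      rfl
    rw [eq_top_iff, ← h1, adjoin_simple_le_iff]
    have hev : ev s wL ∈ ℚ⟮s⟯ := by
      have := ev_map (algebraMap ℚ⟮s⟯ K) (AdjoinSimple.gen ℚ s) wL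
      rw [AdjoinSimple.algebraMap_gen] at this
      rw [← this]
      exact SetLike.coe_mem _
    have : t = ev s wL / ((27707478540903552051946732921 : ℤ) : K) := by
      rw [ht]; field_simp
    rw [this]
    exact div_mem hev (intCast_mem _ _)
  have hms : minpoly ℚ s = pl ℚ (kL ++ [1]) := by
    have hmon := pl_monic (R := ℚ) kL (by simp [kL])
    have hint : IsIntegral ℚ s := Algebra.IsIntegral.isIntegral s
    refine (eq_of_monic_of_dvd_of_natDegree_le (minpoly.monic hint) hmon.1 ?_ ?_).symm
    · exact minpoly.dvd ℚ s (by rw [pl_aeval, hs0])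
    · rw [(Field.primitive_element_iff_minpoly_natDegree_eq ℚ s).1 htop, hK, hmon.2]
      exact le_of_eq rfl
  let t' : 𝓞 K := ⟨t, isInt t fL (by simp [fL]) hm⟩
  let s' : 𝓞 K := ⟨s, isInt s kL (by simp [kL]) hms⟩
  have d1 := pbasis t fL rfl hK hm (derL (fL ++ [1])) (pl_der _) v1 (2 ^ 132 * 3 ^ 36 * 6451 ^ 4)
    (by decide +kernel)
  have d2 := pbasis s kL rfl hK hms (derL (kL ++ [1])) (pl_der _) v2
    (2 ^ 22 * 6451 ^ 4 * 27707478540903552051946732921 ^ 2) (by decide +kernel)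
  obtain ⟨a, ha1, ha2⟩ := index_lem t' hK _ d1
  obtain ⟨b, hb1, hb2⟩ := index_lem s' hK _ d2
  refine arith (discr K) a b 27707478540903552051946732921 (by decide) (by decide) ha1
    (ha2 6451 (by norm_num) (ded6 t' hm)) hb1 (hb2 2 (by norm_num) (ded2 s' hms))
end

end M11

theorem m11_field_from_five_point_family :
    Irreducible f0 ∧
    IsSimpleGroup f0.Gal ∧ Nat.card f0.Gal = 7920 ∧
    ∀ (K : Type) [Field K] [NumberField K],
      Nonempty (AdjoinRoot f0 ≃ₐ[ℚ] K) →
      Module.finrank ℚ K = 12 ∧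
      NumberField.discr K = 2 ^ 22 * 6451 ^ 4 := by
  obtain ⟨h1, h2, h3⟩ := M11.gal_main
  refine ⟨h1, h2, h3, ?_⟩
  intro K _ _ ⟨e⟩
  have hmon := M11.pl_monic (R := ℚ) M11.fL (by simp [M11.fL])
  rw [← M11.f0_eq] at hmon
  have hK : Module.finrank ℚ K = 12 := by
    rw [← e.toLinearEquiv.finrank_eq, (AdjoinRoot.powerBasis h1.ne_zero).finrank,
      AdjoinRoot.powerBasis_dim, hmon.2]
    rfl
  refine ⟨hK, M11.disc_main hK (e (AdjoinRoot.root f0)) ?_⟩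
  rw [← M11.f0_eq]
  refine (minpoly.eq_of_irreducible_of_monic h1 ?_ hmon.1).symm
  rw [Polynomial.aeval_algHom_apply e, AdjoinRoot.aeval_eq, AdjoinRoot.mk_self, map_zero]
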